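/- arXiv:2212.01522 — 4 statements merged into one kernel-verified Lean document; each statement's English description precedes it below -/
import Mathlib

section
/- Consider case (a). Let r > 0, d₁ > 0, q₁ > 0, and let u* ∈ ℝⁿ with u*ᵢ > 0 for all i satisfy the single-species equilibrium system Σ_{j=1}^n (d₁D_{ij} + q₁Q_{ij})u*_j + u*_i(r − u*_i) = 0 for every i. If μ > 0 and there exists φ ≫ 0 with (μd₁D + μq₁Q + diag(r − u*₁,…,r − u*ₙ))φ = 0, then μ = 1. (That is, the curves q = q*_{r−u*}(d) and q = (q₁/d₁)d have exactly one intersection point (d₁,q₁) in the first quadrant.) -/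
open Matrix Filter

/-- Case (a) diffusion matrix (hypothesis H1, stream-to-lake). -/
def Da (n : ℕ) : Matrix (Fin n) (Fin n) ℝ := fun i j =>
  if (i : ℕ) + 1 = (j : ℕ) ∨ (j : ℕ) + 1 = (i : ℕ) then 1
  else if i = j then (if (i : ℕ) = 0 ∨ (i : ℕ) = n - 1 then -1 else -2)
  else 0

/-- Case (b) diffusion matrix (hypothesis H1*, stream-to-ocean). -/
def Db (n : ℕ) : Matrix (Fin n) (Fin n) ℝ := fun i j =>
  if (i : ℕ) + 1 = (j : ℕ) ∨ (j : ℕ) + 1 = (i : ℕ) then 1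
  else if i = j then (if (i : ℕ) = 0 then -1 else -2)
  else 0

/-- Advection (drift) matrix Q. -/
def Qm (n : ℕ) : Matrix (Fin n) (Fin n) ℝ := fun i j =>
  if (j : ℕ) + 1 = (i : ℕ) then 1 else if i = j then -1 else 0


lemma aux_sum (n k : ℕ) (c : ℝ) :
    ∑ j : Fin n, (if k = (j : ℕ) then c else 0) = if k < n then c else 0 := by
  split_ifs with h
  · rw [Finset.sum_eq_single (⟨k, h⟩ : Fin n)]
    · simp
    · intro b _ hb
      rw [if_neg]
      intro e
      exact hb (Fin.ext e.symm)
    · simp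
  · apply Finset.sum_eq_zero
    intro j _
    rw [if_neg]
    have := j.2
    omega

lemma aux_sum2 (n : ℕ) (i : Fin n) :
    ∑ j : Fin n, (if (j : ℕ) + 1 = (i : ℕ) then (1 : ℝ) else 0) = if (i : ℕ) = 0 then 0 else 1 := by
  have hi := i.2
  split_ifs with h
  · apply Finset.sum_eq_zero
    intro j _
    rw [if_neg]
    omega
  · have := aux_sum n ((i : ℕ) - 1) 1
    rw [if_pos (by omega)] at this
    rw [← this]
    apply Finset.sum_congr rfl
    intro j _
    congr 1
    apply propext
    omega

lemma rowsum (n : ℕ) (hn : 2 ≤ n) (d q : ℝ) (i : Fin n) :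
    ∑ j, (d * Da n i j + q * Qm n i j) = if (i : ℕ) = 0 then -q else 0 := by
  have hi := i.2
  have hD : ∀ j, Da n i j = (if (i : ℕ) + 1 = (j : ℕ) then 1 else 0)
      + (if (j : ℕ) + 1 = (i : ℕ) then 1 else 0)
      + (if (i : ℕ) = (j : ℕ) then (if (i : ℕ) = 0 ∨ (i : ℕ) = n - 1 then -1 else -2) else 0) := by
    intro j
    unfold Da
    simp only [Fin.ext_iff]
    split_ifs <;> first | omega | norm_num
  have hQ : ∀ j, Qm n i j = (if (j : ℕ) + 1 = (i : ℕ) then 1 else 0)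
      + (if (i : ℕ) = (j : ℕ) then -1 else 0) := by
    intro j
    unfold Qm
    simp only [Fin.ext_iff]
    split_ifs <;> first | omega | norm_num
  simp only [hD, hQ]
  rw [Finset.sum_add_distrib, ← Finset.mul_sum, ← Finset.mul_sum]
  simp only [Finset.sum_add_distrib, aux_sum, aux_sum2]
  split_ifs <;> first | omega | (exfalso; omega) | ring

lemma offdiag (n : ℕ) (d q : ℝ) (hd : 0 < d) (hq : 0 < q) (i j : Fin n) (h : i ≠ j) :
    0 ≤ d * Da n i j + q * Qm n i j := by
  unfold Da Qm
  simp only [if_neg h]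
  split_ifs <;> simp <;> positivity

lemma symmz (n : ℕ) (d q : ℝ) (hd : 0 < d) (hq : 0 < q) (i j : Fin n) :
    (d / (d + q)) ^ (i : ℕ) * (d * Da n i j + q * Qm n i j)
      = (d / (d + q)) ^ (j : ℕ) * (d * Da n j i + q * Qm n j i) := by
  have hne : d + q ≠ 0 := by positivity
  by_cases h : i = j
  · rw [h]
  by_cases h1 : (i : ℕ) + 1 = j
  · have h2 : ¬ ((j : ℕ) + 1 = i) := by omega
    simp [Da, Qm, h, h1, h2, Ne.symm h]
    rw [← h1, pow_succ]
    field_simp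
  by_cases h2 : (j : ℕ) + 1 = i
  · simp [Da, Qm, h, h1, h2, Ne.symm h]
    rw [← h2, pow_succ]
    field_simp
  simp [Da, Qm, h, h1, h2, Ne.symm h]

/-- in case (a), the curves `q = q*_{r-u*}(d)` and `q = (q₁/d₁)d`
intersect only at `(d₁,q₁)`: if `(μd₁ D + μq₁ Q + diag(r - u*))` has eigenvalue `0` with a
positive eigenvector, then `μ = 1`. -/
theorem stmt_14 (n : ℕ) (hn : 2 ≤ n) (r d₁ q₁ : ℝ) (hr : 0 < r) (hd1 : 0 < d₁) (hq1 : 0 < q₁)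
    (ustar : Fin n → ℝ) (hustar : ∀ i, 0 < ustar i)
    (hueq : ∀ i, (∑ j, (d₁ * Da n i j + q₁ * Qm n i j) * ustar j)
      + ustar i * (r - ustar i) = 0)
    (μ : ℝ) (hμ : 0 < μ)
    (hφ : ∃ φ : Fin n → ℝ, (∀ i, 0 < φ i) ∧
      ((μ * d₁) • Da n + (μ * q₁) • Qm n
        + Matrix.diagonal (fun i => r - ustar i)).mulVec φ = 0) :
    μ = 1 := by
  obtain ⟨φ, hφ0, hφ⟩ := hφ
  set A : Fin n → Fin n → ℝ := fun i j => d₁ * Da n i j + q₁ * Qm n i j with hA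
  have hu : ∀ i, ∑ j, A i j * ustar j = - (ustar i * (r - ustar i)) := by
    intro i
    have := hueq i
    simp only [hA]
    linarith
  have hp : ∀ i, μ * ∑ j, A i j * φ j = - ((r - ustar i) * φ i) := by
    intro i
    have h := congrFun hφ i
    rw [Matrix.add_mulVec, Pi.add_apply, Matrix.mulVec_diagonal] at h
    have h2 : (((μ * d₁) • Da n + (μ * q₁) • Qm n).mulVec φ) i = μ * ∑ j, A i j * φ j := by
      simp only [Matrix.mulVec, dotProduct, Matrix.add_apply, Matrix.smul_apply, smul_eq_mul,
        Finset.mul_sum, hA]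
      apply Finset.sum_congr rfl
      intro j _
      ring
    rw [h2] at h
    simp only [Pi.zero_apply] at h
    linarith
  haveI : Nonempty (Fin n) := ⟨⟨0, by omega⟩⟩
  have hle : ∀ i, ustar i ≤ r := by
    obtain ⟨k, hk⟩ := Finite.exists_max ustar
    have h1 : ∑ j, A k j * ustar j ≤ ∑ j, A k j * ustar k := by
      apply Finset.sum_le_sum
      intro j _
      by_cases h : k = j
      · rw [h]
      · exact mul_le_mul_of_nonneg_left (hk j) (offdiag n d₁ q₁ hd1 hq1 k j h)
    rw [← Finset.sum_mul, hu k] at h1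
    have h2 : ∑ j, A k j ≤ 0 := by
      rw [rowsum n hn]
      split_ifs <;> linarith
    have h3 : 0 ≤ ustar k * (r - ustar k) := by
      have := mul_nonpos_of_nonpos_of_nonneg h2 (hustar k).le
      linarith
    have h4 := nonneg_of_mul_nonneg_right h3 (hustar k)
    intro i
    linarith [hk i]
  set ρ : Fin n → ℝ := fun i => (d₁ / (d₁ + q₁)) ^ (i : ℕ) with hρ
  have hρ0 : ∀ i, 0 < ρ i := fun i => by simp only [hρ]; positivity
  have hsym : ∑ i, ρ i * φ i * ∑ j, A i j * ustar j = ∑ i, ρ i * ustar i * ∑ j, A i j * φ j := by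
    simp only [Finset.mul_sum]
    rw [Finset.sum_comm]
    apply Finset.sum_congr rfl
    intro i _
    apply Finset.sum_congr rfl
    intro j _
    have : ρ j * A j i = ρ i * A i j := symmz n d₁ q₁ hd1 hq1 j i
    linear_combination φ j * ustar i * this
  set S := ∑ i, ρ i * φ i * (ustar i * (r - ustar i)) with hS
  have e1 : ∑ i, ρ i * φ i * ∑ j, A i j * ustar j = - S := by
    rw [hS, ← Finset.sum_neg_distrib]
    apply Finset.sum_congr rfl
    intro i _
    rw [hu]; ring
  have e2 : μ * ∑ i, ρ i * ustar i * ∑ j, A i j * φ j = - S := by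
    rw [hS, ← Finset.sum_neg_distrib, Finset.mul_sum]
    apply Finset.sum_congr rfl
    intro i _
    linear_combination ρ i * ustar i * hp i
  rw [← hsym, e1] at e2
  have hnn : ∀ i ∈ Finset.univ, 0 ≤ ρ i * φ i * (ustar i * (r - ustar i)) := fun i _ =>
    mul_nonneg (mul_pos (hρ0 i) (hφ0 i)).le (mul_nonneg (hustar i).le (by linarith [hle i]))
  have hSne : S ≠ 0 := by
    intro h0
    rw [hS, Finset.sum_eq_zero_iff_of_nonneg hnn] at h0
    have hc : ∀ i, ustar i = r := by
      intro i
      have h := h0 i (Finset.mem_univ i)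
      have a1 := (hρ0 i).ne'
      have a2 := (hφ0 i).ne'
      have a3 := (hustar i).ne'
      have : r - ustar i = 0 := by simpa [a1, a2, a3] using h
      linarith
    have h := hu ⟨0, by omega⟩
    simp only [hc] at h
    rw [← Finset.sum_mul, rowsum n hn] at h
    simp at h
    rcases h with h | h <;> linarith
  have : S * (μ - 1) = 0 := by linarith
  rcases mul_eq_zero.mp this with h | h
  · exact absurd h hSne
  · linarith
end

section
/- Consider case (b). Let r > 0, d₁ > 0, q₁ > 0, and let u* ∈ ℝⁿ with u*ᵢ > 0 for all i satisfy the single-species equilibrium system Σ_{j=1}^n (d₁D_{ij} + q₁Q_{ij})u*_j + u*_i(r − u*_i) = 0 for every i. If μ > 0 and there exists φ ≫ 0 with (μd₁D + μq₁Q + diag(r − u*₁,…,r − u*ₙ))φ = 0, then μ = 1. (That is, the curves q = q*_{r−u*}(d) and q = (q₁/d₁)d have exactly one intersection point (d₁,q₁) in the first quadrant.) -/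
open Matrix Filter

lemma cnt_le (n : ℕ) (p : Fin n → Prop) [DecidablePred p]
    (h : ∀ a b, p a → p b → a = b) : ∑ j, (if p j then (1:ℝ) else 0) ≤ 1 := by
  rw [Finset.sum_boole]
  have : (Finset.univ.filter p).card ≤ 1 := by
    rw [Finset.card_le_one]
    intro a ha b hb
    simp at ha hb
    exact h a b ha hb
  exact_mod_cast this

lemma cnt_prev (n : ℕ) (i : Fin n) :
    ∑ j : Fin n, (if (j:ℕ) + 1 = (i:ℕ) then (1:ℝ) else 0) ≤ if (i:ℕ) = 0 then 0 else 1 := by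
  split_ifs with h
  · rw [h]; simp
  · apply cnt_le
    intro a b ha hb
    apply Fin.ext; omega

lemma row_Q (n : ℕ) (i : Fin n) : ∑ j, Qm n i j ≤ if (i:ℕ) = 0 then -1 else 0 := by
  have h : ∀ j, Qm n i j = (if (j:ℕ) + 1 = (i:ℕ) then (1:ℝ) else 0) - (if i = j then 1 else 0) := by
    intro j
    unfold Qm
    by_cases h1 : i = j
    · subst h1; simp
    · simp [h1]
  simp_rw [h]
  rw [Finset.sum_sub_distrib, Finset.sum_ite_eq]
  have := cnt_prev n i
  simp only [Finset.mem_univ, if_true]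
  split_ifs at this ⊢ <;> linarith

lemma row_D (n : ℕ) (i : Fin n) : ∑ j, Db n i j ≤ 0 := by
  have h : ∀ j, Db n i j = (if (i:ℕ) + 1 = (j:ℕ) then (1:ℝ) else 0)
      + (if (j:ℕ) + 1 = (i:ℕ) then (1:ℝ) else 0)
      + (if i = j then (if (i:ℕ) = 0 then -1 else -2) else 0) := by
    intro j
    unfold Db
    by_cases h1 : i = j
    · subst h1; simp
    · by_cases h2 : (i:ℕ) + 1 = (j:ℕ)
      · have h3 : ¬ ((j:ℕ) + 1 = (i:ℕ)) := by omega
        simp [h1, h2, h3]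
      · simp [h1, h2]
  simp_rw [h]
  rw [Finset.sum_add_distrib, Finset.sum_add_distrib, Finset.sum_ite_eq]
  have h1 := cnt_prev n i
  have h2 := cnt_le n (fun j => (i:ℕ) + 1 = (j:ℕ)) (by intro a b ha hb; apply Fin.ext; omega)
  simp only [Finset.mem_univ, if_true]
  split_ifs at h1 ⊢ <;> linarith

lemma row_A (n : ℕ) (d q : ℝ) (hd : 0 < d) (hq : 0 < q) (i : Fin n) :
    ∑ j, (d * Db n i j + q * Qm n i j) ≤ if (i:ℕ) = 0 then -q else 0 := by
  rw [Finset.sum_add_distrib, ← Finset.mul_sum, ← Finset.mul_sum]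
  have h1 := row_D n i
  have h2 := row_Q n i
  split_ifs at h2 ⊢ <;> nlinarith

lemma off_A (n : ℕ) (d q : ℝ) (hd : 0 < d) (hq : 0 < q) (i j : Fin n) (h : i ≠ j) :
    0 ≤ d * Db n i j + q * Qm n i j := by
  unfold Db Qm
  simp only [h, if_false]
  split_ifs <;> simp <;> positivity

lemma sym_A (n : ℕ) (d q : ℝ) (hd : 0 < d) (hq : 0 < q) (i j : Fin n) :
    (d / (d + q)) ^ (i:ℕ) * (d * Db n i j + q * Qm n i j)
      = (d / (d + q)) ^ (j:ℕ) * (d * Db n j i + q * Qm n j i) := by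
  have hs : d + q ≠ 0 := by positivity
  by_cases h1 : i = j
  · subst h1; rfl
  have h1' : j ≠ i := fun h => h1 h.symm
  by_cases h2 : (i:ℕ) + 1 = (j:ℕ)
  · have h3 : ¬ ((j:ℕ) + 1 = (i:ℕ)) := by omega
    simp only [Db, Qm, h1, h1', h2, h3, if_true, if_false, or_true, true_or]
    rw [← h2, pow_succ]
    field_simp
    try ring
  by_cases h3 : (j:ℕ) + 1 = (i:ℕ)
  · simp only [Db, Qm, h1, h1', h2, h3, if_true, if_false, or_true, true_or]
    rw [← h3, pow_succ]
    field_simp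
    try ring
  · simp [Db, Qm, h1, h1', h2, h3]

theorem stmt_15 (n : ℕ) (hn : 2 ≤ n) (r d₁ q₁ : ℝ) (hr : 0 < r) (hd1 : 0 < d₁) (hq1 : 0 < q₁)
    (ustar : Fin n → ℝ) (hustar : ∀ i, 0 < ustar i)
    (hueq : ∀ i, (∑ j, (d₁ * Db n i j + q₁ * Qm n i j) * ustar j)
      + ustar i * (r - ustar i) = 0)
    (μ : ℝ) (hμ : 0 < μ)
    (hφ : ∃ φ : Fin n → ℝ, (∀ i, 0 < φ i) ∧
      ((μ * d₁) • Db n + (μ * q₁) • Qm n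
        + Matrix.diagonal (fun i => r - ustar i)).mulVec φ = 0) :
    μ = 1 := by
  obtain ⟨φ, hpos, heq⟩ := hφ
  have hφeq : ∀ i, μ * (∑ j, (d₁ * Db n i j + q₁ * Qm n i j) * φ j) + (r - ustar i) * φ i = 0 := by
    intro i
    have h := congrFun heq i
    rw [Matrix.add_mulVec, Pi.add_apply, Matrix.mulVec_diagonal] at h
    rw [← Pi.zero_apply (M := fun _ => ℝ) i, ← h, Finset.mul_sum]
    congr 1
    simp only [Matrix.mulVec, dotProduct, Matrix.add_apply, Matrix.smul_apply, smul_eq_mul]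
    apply Finset.sum_congr rfl
    intro j _
    ring
  haveI : Nonempty (Fin n) := ⟨⟨0, by omega⟩⟩
  have hle : ∀ i, ustar i ≤ r := by
    obtain ⟨k, hk⟩ := Finite.exists_max ustar
    have h1 : ∑ j, (d₁ * Db n k j + q₁ * Qm n k j) * ustar j
        ≤ ∑ j, (d₁ * Db n k j + q₁ * Qm n k j) * ustar k := by
      apply Finset.sum_le_sum
      intro j _
      by_cases h : k = j
      · rw [h]
      · exact mul_le_mul_of_nonneg_left (hk j) (off_A n d₁ q₁ hd1 hq1 k j h)
    rw [← Finset.sum_mul] at h1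
    have h2 := row_A n d₁ q₁ hd1 hq1 k
    have h3 : ∑ j, (d₁ * Db n k j + q₁ * Qm n k j) ≤ 0 := by
      split_ifs at h2 <;> linarith
    have h4 := hueq k
    have h5 := mul_nonpos_of_nonpos_of_nonneg h3 (hustar k).le
    have h6 : 0 ≤ ustar k * (r - ustar k) := by linarith
    have h7 := nonneg_of_mul_nonneg_right h6 (hustar k)
    intro i
    linarith [hk i]
  have hlt : ∃ i, ustar i < r := by
    by_contra hcon
    push Not at hcon
    have he : ∀ i, ustar i = r := fun i => le_antisymm (hle i) (hcon i)
    have h4 := hueq ⟨0, by omega⟩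
    simp only [he] at h4
    rw [← Finset.sum_mul] at h4
    have h2 := row_A n d₁ q₁ hd1 hq1 ⟨0, by omega⟩
    simp only [if_true] at h2
    nlinarith
  set w : Fin n → ℝ := fun i => (d₁ / (d₁ + q₁)) ^ (i:ℕ) with hw
  have hwpos : ∀ i, 0 < w i := fun i => by simp only [hw]; positivity
  have hsym : ∑ i, w i * φ i * (∑ j, (d₁ * Db n i j + q₁ * Qm n i j) * ustar j)
      = ∑ i, w i * ustar i * (∑ j, (d₁ * Db n i j + q₁ * Qm n i j) * φ j) := by
    simp_rw [Finset.mul_sum]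
    rw [Finset.sum_comm]
    apply Finset.sum_congr rfl
    intro i _
    apply Finset.sum_congr rfl
    intro j _
    have := sym_A n d₁ q₁ hd1 hq1 i j
    simp only [hw]
    linear_combination (-ustar i * φ j) * this
  have hS : 0 < ∑ i, w i * φ i * ustar i * (r - ustar i) := by
    apply Finset.sum_pos'
    · intro i _
      have := hwpos i; have := hpos i; have := hustar i; have := sub_nonneg.2 (hle i)
      positivity
    · obtain ⟨i, hi⟩ := hlt
      refine ⟨i, Finset.mem_univ _, ?_⟩
      have := hwpos i; have := hpos i; have := hustar i; have := sub_pos.2 hi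
      positivity
  have e1 : ∑ i, w i * φ i * (∑ j, (d₁ * Db n i j + q₁ * Qm n i j) * ustar j)
      = - ∑ i, w i * φ i * ustar i * (r - ustar i) := by
    rw [← Finset.sum_neg_distrib]
    apply Finset.sum_congr rfl
    intro i _
    linear_combination (w i * φ i) * hueq i
  have e2 : μ * ∑ i, w i * ustar i * (∑ j, (d₁ * Db n i j + q₁ * Qm n i j) * φ j)
      = - ∑ i, w i * φ i * ustar i * (r - ustar i) := by
    rw [← Finset.sum_neg_distrib, Finset.mul_sum]
    apply Finset.sum_congr rfl
    intro i _
    linear_combination (w i * ustar i) * hφeq i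
  rw [← hsym, e1] at e2
  have : (μ - 1) * ∑ i, w i * φ i * ustar i * (r - ustar i) = 0 := by linear_combination -e2
  rcases mul_eq_zero.1 this with h | h
  · linarith
  · exact absurd h hS.ne'
end

section
/- Consider case (a). Let r > 0 and d₁, q₁ > 0, and assume hypothesis H2: there exist λ > 0 and w ≫ 0 with (d₁D + q₁Q + diag(r,…,r))w = λw (i.e., the principal eigenvalue λ₁(d₁,q₁,(r,…,r)) is positive). Let d₂, q₂ > 0 with (d₂,q₂) ∈ G₁ ∪ G₂, where G₁ = {(d,q) : 0 < d ≤ (d₁/q₁)q, q ≥ q₁, (d,q) ≠ (d₁,q₁)} and G₂ = {(d,q) : d ≥ (d₁/q₁)q, 0 < q ≤ q₁, (d,q) ≠ (d₁,q₁)}. Then there exists no pair (û, v̂) with ûᵢ > 0 and v̂ᵢ > 0 for all i satisfying, for every i = 1,…,n: Σ_{j=1}^n (d₁D_{ij} + q₁Q_{ij})û_j + û_i(r − û_i − v̂_i) = 0 and Σ_{j=1}^n (d₂D_{ij} + q₂Q_{ij})v̂_j + v̂_i(r − û_i − v̂_i) = 0. (The two-species competition model has no positive equilibrium.) -/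
open Matrix Filter

theorem aux_caseA (N : ℕ) (d₁ q₁ d₂ q₂ : ℝ) (hd1 : 0 < d₁) (hq1 : 0 < q₁) (hd2 : 0 < d₂)
    (hq2 : 0 < q₂) (hd : d₁ ≤ d₂) (hdq : d₂ * q₁ ≤ d₁ * q₂) (hne : ¬ (d₂ = d₁ ∧ q₂ = q₁))
    (X Y m : ℕ → ℝ) (hm : ∀ k ≤ N, 0 < m k) (hX : ∀ k ≤ N, 1 ≤ X k)
    (hX0 : d₁ * (X 0 - 1) = q₁ - m 0) (hY0 : d₂ * (Y 0 - 1) = q₂ - m 0)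
    (hXs : ∀ k < N, d₁ * (X (k+1) - 1) = (d₁ + q₁) * (1 - 1 / X k) - m (k+1))
    (hYs : ∀ k < N, d₂ * (Y (k+1) - 1) = (d₂ + q₂) * (1 - 1 / Y k) - m (k+1)) :
    ∀ k ≤ N, X k < Y k := by
  have hp : 0 < d₁ * d₂ := mul_pos hd1 hd2
  intro k
  induction k with
  | zero =>
    intro _
    have h0 := hm 0 (Nat.zero_le _)
    have e : d₁ * d₂ * (Y 0 - X 0) = (d₁ * q₂ - d₂ * q₁) + (d₂ - d₁) * m 0 := by
      linear_combination d₁ * hY0 - d₂ * hX0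
    have : 0 < d₁ * d₂ * (Y 0 - X 0) := by
      rw [e]
      rcases hd.lt_or_eq with h | h
      · have := mul_pos (sub_pos.2 h) h0
        linarith
      · subst h
        have h1 : q₁ ≤ q₂ := le_of_mul_le_mul_left hdq hd1
        have h2 : q₁ < q₂ := lt_of_le_of_ne h1 (fun h => hne ⟨rfl, h.symm⟩)
        have := mul_pos hd1 (sub_pos.2 h2)
        linarith
    have := (mul_pos_iff_of_pos_left hp).1 this
    linarith
  | succ k ih =>
    intro hk
    have ih := ih (by omega)
    have hx := hX k (by omega)
    have hmk := hm (k+1) hk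
    have e1 := hXs k (by omega)
    have e2 := hYs k (by omega)
    have hlt : 1 / Y k < 1 / X k := one_div_lt_one_div_of_lt (by linarith) ih
    have hx1 : 1 / X k ≤ 1 := by
      rw [div_le_one (by linarith)]; exact hx
    set a := 1 / X k
    set b := 1 / Y k
    have e : d₁ * d₂ * (Y (k+1) - X (k+1)) = d₁ * (d₂ + q₂) * (a - b)
        + (d₁ * q₂ - d₂ * q₁) * (1 - a) + (d₂ - d₁) * m (k+1) := by
      linear_combination d₁ * e2 - d₂ * e1
    have t1 : 0 < d₁ * (d₂ + q₂) * (a - b) := by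
      apply mul_pos (by positivity); linarith
    have t2 : 0 ≤ (d₁ * q₂ - d₂ * q₁) * (1 - a) := mul_nonneg (by linarith) (by linarith)
    have t3 : 0 ≤ (d₂ - d₁) * m (k+1) := mul_nonneg (by linarith) hmk.le
    have : 0 < d₁ * d₂ * (Y (k+1) - X (k+1)) := by rw [e]; linarith
    have := (mul_pos_iff_of_pos_left hp).1 this
    linarith

theorem aux_caseB (N : ℕ) (d₁ q₁ d₂ q₂ : ℝ) (hd2 : 0 < d₂)
    (hd : d₂ < d₁) (hq : q₁ ≤ q₂)
    (X Y m : ℕ → ℝ) (hm : ∀ k ≤ N, 0 < m k) (hX : ∀ k ≤ N, 1 ≤ X k) (hX0' : 1 < X 0)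
    (hX0 : d₁ * (X 0 - 1) = q₁ - m 0) (hY0 : d₂ * (Y 0 - 1) = q₂ - m 0)
    (hXs : ∀ k < N, d₁ * (X (k+1) - 1) = (d₁ + q₁) * (1 - 1 / X k) - m (k+1))
    (hYs : ∀ k < N, d₂ * (Y (k+1) - 1) = (d₂ + q₂) * (1 - 1 / Y k) - m (k+1)) :
    ∀ k ≤ N, 0 < q₂ - d₂ * (Y k - 1) ∧ q₂ - d₂ * (Y k - 1) ≤ q₁ - d₁ * (X k - 1) ∧
      X k ≤ Y k ∧ (1 ≤ k → q₂ - d₂ * (Y k - 1) < q₁ - d₁ * (X k - 1)) ∧ (k = 0 → X k < Y k) := by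
  intro k
  induction k with
  | zero =>
    intro _
    have h0 := hm 0 (Nat.zero_le _)
    have : X 0 < Y 0 := by nlinarith
    refine ⟨by linarith, by linarith, this.le, by omega, fun _ => this⟩
  | succ k ih =>
    intro hk
    obtain ⟨i1, i2, i3, i4, i5⟩ := ih (by omega)
    have hx := hX k (by omega)
    have hx' := hX (k+1) hk
    have hmk := hm (k+1) hk
    have e1 := hXs k (by omega)
    have e2 := hYs k (by omega)
    have xp : 0 < X k := by linarith
    have yp : 0 < Y k := by linarith
    have f1 : q₁ - d₁ * (X (k+1) - 1) = m (k+1) + (q₁ - d₁ * (X k - 1)) / X k := by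
      rw [e1]; field_simp; ring
    have f2 : q₂ - d₂ * (Y (k+1) - 1) = m (k+1) + (q₂ - d₂ * (Y k - 1)) / Y k := by
      rw [e2]; field_simp; ring
    have hlt : (q₂ - d₂ * (Y k - 1)) / Y k < (q₁ - d₁ * (X k - 1)) / X k := by
      rw [div_lt_div_iff₀ yp xp]
      rcases Nat.eq_zero_or_pos k with h | h
      · have := i5 h
        nlinarith
      · have := i4 h
        nlinarith
    have hpos := div_pos i1 yp
    have hF : q₂ - d₂ * (Y (k+1) - 1) < q₁ - d₁ * (X (k+1) - 1) := by rw [f1, f2]; linarith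
    refine ⟨by rw [f2]; linarith, hF.le, ?_, fun _ => hF, by omega⟩
    nlinarith

theorem aux_seq (N : ℕ) (hN : 1 ≤ N) (r d₁ q₁ d₂ q₂ : ℝ)
    (hd1 : 0 < d₁) (hq1 : 0 < q₁) (hd2 : 0 < d₂) (hq2 : 0 < q₂)
    (hdq : d₂ * q₁ ≤ d₁ * q₂) (hq : q₁ ≤ q₂) (hne : ¬ (d₂ = d₁ ∧ q₂ = q₁))
    (U V : ℕ → ℝ) (hU : ∀ k, 0 < U k) (hV : ∀ k, 0 < V k)
    (hUN : U (N+1) = U N) (hVN : V (N+1) = V N)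
    (hU0 : d₁ * (U 1 - U 0) = q₁ * U 0 - U 0 * (r - U 0 - V 0))
    (hV0 : d₂ * (V 1 - V 0) = q₂ * V 0 - V 0 * (r - U 0 - V 0))
    (hUs : ∀ k < N, d₁ * (U (k+2) - U (k+1)) = (d₁ + q₁) * (U (k+1) - U k)
      - U (k+1) * (r - U (k+1) - V (k+1)))
    (hVs : ∀ k < N, d₂ * (V (k+2) - V (k+1)) = (d₂ + q₂) * (V (k+1) - V k)
      - V (k+1) * (r - U (k+1) - V (k+1))) : False := by
  have hmN : 0 < r - U N - V N := by
    by_contra hc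
    push Not at hc
    have key : ∀ j ≤ N, ∀ k, k + j = N →
        r - U k - V k ≤ 0 ∧ U (k+1) ≤ U k ∧ V (k+1) ≤ V k := by
      intro j
      induction j with
      | zero =>
        intro _ k hk
        obtain rfl : k = N := by omega
        exact ⟨hc, hUN.le, hVN.le⟩
      | succ j ih =>
        intro hj k hk
        obtain ⟨a, b, c⟩ := ih (by omega) (k+1) (by omega)
        have e1 := hUs k (by omega)
        have e2 := hVs k (by omega)
        have p1 := mul_nonneg (hU (k+1)).le (neg_nonneg.2 a)
        have p2 := mul_nonneg (hV (k+1)).le (neg_nonneg.2 a)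
        have p3 := mul_nonneg hd1.le (sub_nonneg.2 b)
        have p4 := mul_nonneg hd2.le (sub_nonneg.2 c)
        have s1 : U (k+1) ≤ U k := by
          by_contra h
          have := mul_pos (add_pos hd1 hq1) (sub_pos.2 (not_le.1 h))
          linarith
        have s2 : V (k+1) ≤ V k := by
          by_contra h
          have := mul_pos (add_pos hd2 hq2) (sub_pos.2 (not_le.1 h))
          linarith
        exact ⟨by linarith, s1, s2⟩
    obtain ⟨a, b, c⟩ := key N le_rfl 0 (by omega)
    have p1 := mul_nonneg (hU 0).le (neg_nonneg.2 a)
    have p3 := mul_nonneg hd1.le (sub_nonneg.2 b)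
    have := mul_pos hq1 (hU 0)
    simp only [zero_add] at *
    linarith
  have key : ∀ j ≤ N, ∀ k, k + j = N →
      0 < r - U k - V k ∧ U k ≤ U (k+1) ∧ V k ≤ V (k+1) ∧
        (1 ≤ j → U k < U (k+1) ∧ V k < V (k+1)) := by
    intro j
    induction j with
    | zero =>
      intro _ k hk
      obtain rfl : k = N := by omega
      exact ⟨hmN, hUN.ge, hVN.ge, by omega⟩
    | succ j ih =>
      intro hj k hk
      obtain ⟨a, b, c, -⟩ := ih (by omega) (k+1) (by omega)
      have e1 := hUs k (by omega)
      have e2 := hVs k (by omega)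
      have p1 := mul_pos (hU (k+1)) a
      have p2 := mul_pos (hV (k+1)) a
      have p3 := mul_nonneg hd1.le (sub_nonneg.2 b)
      have p4 := mul_nonneg hd2.le (sub_nonneg.2 c)
      have s1 : U k < U (k+1) := by
        by_contra h
        have := mul_nonneg (add_pos hd1 hq1).le (sub_nonneg.2 (not_lt.1 h))
        linarith
      have s2 : V k < V (k+1) := by
        by_contra h
        have := mul_nonneg (add_pos hd2 hq2).le (sub_nonneg.2 (not_lt.1 h))
        linarith
      exact ⟨by linarith, s1.le, s2.le, fun _ => ⟨s1, s2⟩⟩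
  have hm : ∀ k ≤ N, 0 < (fun k => r - U k - V k) k := fun k hk =>
    (key (N - k) (by omega) k (by omega)).1
  have hX : ∀ k ≤ N, 1 ≤ (fun k => U (k+1) / U k) k := fun k hk => by
    have := (key (N - k) (by omega) k (by omega)).2.1
    simp only
    rwa [one_le_div (hU k)]
  have hX0 : d₁ * (U 1 / U 0 - 1) = q₁ - (r - U 0 - V 0) := by
    have := (hU 0).ne'
    field_simp
    linarith
  have hY0 : d₂ * (V 1 / V 0 - 1) = q₂ - (r - U 0 - V 0) := by
    have := (hV 0).ne'
    field_simp
    linarith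
  have hXs : ∀ k < N, d₁ * (U (k+2) / U (k+1) - 1) = (d₁ + q₁) * (1 - 1 / (U (k+1) / U k))
      - (r - U (k+1) - V (k+1)) := by
    intro k hk
    have := (hU k).ne'
    have := (hU (k+1)).ne'
    have := hUs k hk
    field_simp
    linarith
  have hYs : ∀ k < N, d₂ * (V (k+2) / V (k+1) - 1) = (d₂ + q₂) * (1 - 1 / (V (k+1) / V k))
      - (r - U (k+1) - V (k+1)) := by
    intro k hk
    have := (hV k).ne'
    have := (hV (k+1)).ne'
    have := hVs k hk
    field_simp
    linarith
  have hXN : U (N+1) / U N = 1 := by rw [hUN]; exact div_self (hU N).ne'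
  have hYN : V (N+1) / V N = 1 := by rw [hVN]; exact div_self (hV N).ne'
  rcases le_or_gt d₁ d₂ with h | h
  · have := aux_caseA N d₁ q₁ d₂ q₂ hd1 hq1 hd2 hq2 h hdq hne (fun k => U (k+1) / U k)
      (fun k => V (k+1) / V k) (fun k => r - U k - V k) hm hX hX0 hY0 hXs hYs N le_rfl
    simp only [hXN, hYN] at this
    exact lt_irrefl _ this
  · have hX0' : 1 < U 1 / U 0 := by
      rw [one_lt_div (hU 0)]
      exact ((key N le_rfl 0 (by omega)).2.2.2 hN).1
    have := (aux_caseB N d₁ q₁ d₂ q₂ hd2 h hq (fun k => U (k+1) / U k)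
      (fun k => V (k+1) / V k) (fun k => r - U k - V k) hm hX hX0' hX0 hY0 hXs hYs N
      le_rfl).2.2.2.1 hN
    simp only [hXN, hYN] at this
    linarith

theorem aux_row (N : ℕ) (hN : 1 ≤ N) (d q : ℝ) (w : Fin (N+1) → ℝ) (i : Fin (N+1)) (W : ℕ → ℝ)
    (hW : ∀ j : Fin (N+1), W j = w j) (hWN : W (N+1) = W N) :
    (∑ j, (d * Da (N+1) i j + q * Qm (N+1) i j) * w j) =
      d * (W (i+1) - W i) + (if (i:ℕ) = 0 then - q * W i else (d + q) * (W (i-1) - W i)) := by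
  have h1 : ∀ j : Fin (N+1), (d * Da (N+1) i j + q * Qm (N+1) i j) * w j =
      (fun k : ℕ => (if k = (i:ℕ) + 1 then d * W k else 0)
        + (if k = (i:ℕ) then ((if (i:ℕ) = 0 ∨ (i:ℕ) = N then -d else -2 * d) - q) * W k else 0)
        + (if (i:ℕ) = 0 then 0 else if k = (i:ℕ) - 1 then (d + q) * W k else 0)) (j:ℕ) := by
    intro j
    have hj := hW j
    simp only [Da, Qm, Fin.ext_iff, ← hj, Nat.add_sub_cancel]
    have := i.2
    have := j.2
    split_ifs <;> first | omega | (ring)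
  rw [Finset.sum_congr rfl (fun j _ => h1 j),
    Fin.sum_univ_eq_sum_range (fun k : ℕ => (if k = (i:ℕ) + 1 then d * W k else 0)
        + (if k = (i:ℕ) then ((if (i:ℕ) = 0 ∨ (i:ℕ) = N then -d else -2 * d) - q) * W k else 0)
        + (if (i:ℕ) = 0 then 0 else if k = (i:ℕ) - 1 then (d + q) * W k else 0)) (N+1), Finset.sum_add_distrib, Finset.sum_add_distrib]
  have hi := i.2
  rcases Nat.eq_zero_or_pos (i:ℕ) with h0 | h0
  · simp only [h0, Finset.sum_ite_eq', Finset.mem_range]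
    have : 0 + 1 < N + 1 := by omega
    simp [this, show 0 < N from hN]
    ring
  · have h0' : (i:ℕ) ≠ 0 := by omega
    simp only [h0', if_false, Finset.sum_ite_eq', Finset.mem_range, hi, if_true, false_or,
      show (i:ℕ) - 1 < N + 1 by omega]
    by_cases hl : (i:ℕ) = N
    · simp [hl, hWN]; ring
    · have : (i:ℕ) + 1 < N + 1 := by omega
      simp only [hl, this, if_true, if_false]; ring

theorem aux_main (N : ℕ) (hN : 1 ≤ N) (r d₁ q₁ d₂ q₂ : ℝ)
    (hd1 : 0 < d₁) (hq1 : 0 < q₁) (hd2 : 0 < d₂) (hq2 : 0 < q₂)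
    (hdq : d₂ * q₁ ≤ d₁ * q₂) (hq : q₁ ≤ q₂) (hne : ¬ (d₂ = d₁ ∧ q₂ = q₁))
    (u v : Fin (N+1) → ℝ) (hu : ∀ i, 0 < u i) (hv : ∀ i, 0 < v i)
    (eu : ∀ i, (∑ j, (d₁ * Da (N+1) i j + q₁ * Qm (N+1) i j) * u j)
        + u i * (r - u i - v i) = 0)
    (ev : ∀ i, (∑ j, (d₂ * Da (N+1) i j + q₂ * Qm (N+1) i j) * v j)
        + v i * (r - u i - v i) = 0) : False := by
  obtain ⟨U, hU⟩ : ∃ U : ℕ → ℝ, ∀ k, U k = u ⟨min k N, by omega⟩ := ⟨_, fun _ => rfl⟩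
  obtain ⟨V, hV⟩ : ∃ V : ℕ → ℝ, ∀ k, V k = v ⟨min k N, by omega⟩ := ⟨_, fun _ => rfl⟩
  have hUu : ∀ j : Fin (N+1), U j = u j := fun j => by
    rw [hU]; congr 1; ext; simp; omega
  have hVv : ∀ j : Fin (N+1), V j = v j := fun j => by
    rw [hV]; congr 1; ext; simp; omega
  have hUN : U (N+1) = U N := by rw [hU, hU]; congr 2; omega
  have hVN : V (N+1) = V N := by rw [hV, hV]; congr 2; omega
  have fu := fun i => (aux_row N hN d₁ q₁ u i U hUu hUN).symm
  have fv := fun i => (aux_row N hN d₂ q₂ v i V hVv hVN).symm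
  have gu : ∀ i : Fin (N+1), _ := fun i => by
    have := eu i
    rw [← fu i, ← hUu i, ← hVv i] at this
    exact this
  have gv : ∀ i : Fin (N+1), _ := fun i => by
    have := ev i
    rw [← fv i, ← hUu i, ← hVv i] at this
    exact this
  refine aux_seq N hN r d₁ q₁ d₂ q₂ hd1 hq1 hd2 hq2 hdq hq hne U V
    (fun k => by rw [hU]; exact hu _) (fun k => by rw [hV]; exact hv _) hUN hVN ?_ ?_ ?_ ?_
  · have := gu ⟨0, by omega⟩
    simp at this
    linarith
  · have := gv ⟨0, by omega⟩
    simp at this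
    linarith
  · intro k hk
    have := gu ⟨k+1, by omega⟩
    simp at this
    linarith
  · intro k hk
    have := gv ⟨k+1, by omega⟩
    simp at this
    linarith

/-- in case (a), under H2 and `(d₂,q₂) ∈ G₁ ∪ G₂`, the two-species
competition model has no positive equilibrium. -/
theorem stmt_16 (n : ℕ) (hn : 2 ≤ n) (r d₁ q₁ d₂ q₂ : ℝ)
    (hr : 0 < r) (hd1 : 0 < d₁) (hq1 : 0 < q₁) (hd2 : 0 < d₂) (hq2 : 0 < q₂)
    (H2 : ∃ lam : ℝ, 0 < lam ∧ ∃ w : Fin n → ℝ, (∀ i, 0 < w i) ∧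
      (d₁ • Da n + q₁ • Qm n + Matrix.diagonal (fun _ : Fin n => r)).mulVec w = lam • w)
    (hG : (d₂ ≤ d₁ / q₁ * q₂ ∧ q₁ ≤ q₂ ∧ (d₂, q₂) ≠ (d₁, q₁)) ∨
          (d₁ / q₁ * q₂ ≤ d₂ ∧ q₂ ≤ q₁ ∧ (d₂, q₂) ≠ (d₁, q₁))) :
    ¬ ∃ (uh vh : Fin n → ℝ), (∀ i, 0 < uh i) ∧ (∀ i, 0 < vh i) ∧
      (∀ i, (∑ j, (d₁ * Da n i j + q₁ * Qm n i j) * uh j)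
        + uh i * (r - uh i - vh i) = 0) ∧
      (∀ i, (∑ j, (d₂ * Da n i j + q₂ * Qm n i j) * vh j)
        + vh i * (r - uh i - vh i) = 0) := by
  rintro ⟨u, v, hu, hv, eu, ev⟩
  obtain ⟨N, rfl⟩ : ∃ N, n = N + 1 := ⟨n - 1, by omega⟩
  rcases hG with ⟨h1, h2, h3⟩ | ⟨h1, h2, h3⟩
  · have hdq : d₂ * q₁ ≤ d₁ * q₂ := by
      rw [div_mul_eq_mul_div, le_div_iff₀ hq1] at h1
      exact h1
    exact aux_main N (by omega) r d₁ q₁ d₂ q₂ hd1 hq1 hd2 hq2 hdq h2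
      (fun h => h3 (by rw [h.1, h.2])) u v hu hv eu ev
  · have hdq : d₁ * q₂ ≤ d₂ * q₁ := by
      rw [div_mul_eq_mul_div, div_le_iff₀ hq1] at h1
      exact h1
    refine aux_main N (by omega) r d₂ q₂ d₁ q₁ hd2 hq2 hd1 hq1 hdq h2
      (fun h => h3 (by rw [h.1, h.2])) v u hv hu ?_ ?_
    · intro i
      rw [← ev i]; ring
    · intro i
      rw [← eu i]; ring
end

section
/- Consider case (a). Let r > 0, d₁, q₁ > 0, and let u* ≫ 0 satisfy Σ_{j=1}^n (d₁D_{ij} + q₁Q_{ij})u*_j + u*_i(r − u*_i) = 0 for all i (the species-u-only semi-trivial equilibrium). Let d₂, q₂ > 0 and let u, v : [0,∞) → ℝⁿ be differentiable functions satisfying, for all t ≥ 0 and all i: u′ᵢ(t) = Σ_{j=1}^n (d₁D_{ij} + q₁Q_{ij})u_j(t) + u_i(t)(r − u_i(t) − v_i(t)) and v′ᵢ(t) = Σ_{j=1}^n (d₂D_{ij} + q₂Q_{ij})v_j(t) + v_i(t)(r − u_i(t) − v_i(t)), with u(0) ≥ 0 and v(0) ≥ 0 componentwise. (i) If (d₂,q₂)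 ∈ G₁ = {(d,q) : 0 < d ≤ (d₁/q₁)q, q ≥ q₁, (d,q) ≠ (d₁,q₁)} and u(0) ≠ 0, then u_i(t) → u*_i and v_i(t) → 0 as t → ∞ for every i. (ii) If (d₂,q₂) ∈ G₂ = {(d,q) : d ≥ (d₁/q₁)q, 0 < q ≤ q₁, (d,q) ≠ (d₁,q₁)} and v(0) ≠ 0, then there exists a unique v* ≫ 0 with Σ_{j=1}^n (d₂D_{ij} + q₂Q_{ij})v*_j + v*_i(r − v*_i) = 0 for all i, and u_i(t) → 0 and v_i(t) → v*_i as t → ∞ for every i. -/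
open Matrix Filter

set_option linter.unusedSimpArgs false

/-- the matrix of the movement operator -/
def Lm (n : ℕ) (d q : ℝ) : Fin n → Fin n → ℝ := fun i j => d * Da n i j + q * Qm n i j

/-- prow of the movement operator, on sequences -/
noncomputable def prow (d q : ℝ) (n : ℕ) (W : ℕ → ℝ) (k : ℕ) : ℝ :=
  (if k + 1 < n then d * (W (k+1) - W k) else 0)
    - (if k = 0 then q * W 0 else (d + q) * (W k - W (k-1)))

noncomputable def ext0 {n : ℕ} (w : Fin n → ℝ) (k : ℕ) : ℝ := if h : k < n then w ⟨k, h⟩ else 0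

lemma ext0_fin {n : ℕ} (w : Fin n → ℝ) (i : Fin n) : ext0 w i = w i := by
  simp [ext0]

lemma Lm_row (n : ℕ) (hn : 2 ≤ n) (d q : ℝ) (W : ℕ → ℝ) (i : Fin n) :
    ∑ j : Fin n, Lm n d q i j * W j = prow d q n W i := by
  obtain ⟨k, hk⟩ := i
  have h1 : ∀ j : Fin n, Lm n d q ⟨k, hk⟩ j * W j =
      (fun j : ℕ => (if k + 1 = j then d * W j else 0) +
        (if k - 1 = j then (if k = 0 then 0 else (d+q) * W j) else 0) +
        (if k = j then ((if k = 0 ∨ k = n - 1 then -d else -2*d) - q) * W j else 0)) (j : ℕ) := by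
    intro ⟨j, hj⟩
    simp only [Lm, Da, Qm, Fin.mk.injEq]
    split_ifs <;> first | (exfalso; omega) | ring
  rw [Finset.sum_congr rfl (fun j _ => h1 j)]
  rw [Fin.sum_univ_eq_sum_range (fun j : ℕ => (if k + 1 = j then d * W j else 0) +
        (if k - 1 = j then (if k = 0 then 0 else (d+q) * W j) else 0) +
        (if k = j then ((if k = 0 ∨ k = n - 1 then -d else -2*d) - q) * W j else 0)) n]
  rw [Finset.sum_add_distrib, Finset.sum_add_distrib, Finset.sum_ite_eq, Finset.sum_ite_eq,
    Finset.sum_ite_eq]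
  simp only [Finset.mem_range, prow]
  rcases Nat.eq_zero_or_pos k with h0 | h0
  · subst h0
    split_ifs <;> first | (exfalso; omega) | (simp only [zero_add]; ring)
  · split_ifs <;> first | (exfalso; omega) | ring

lemma Lm_row' (n : ℕ) (hn : 2 ≤ n) (d q : ℝ) (w : Fin n → ℝ) (i : Fin n) :
    ∑ j : Fin n, Lm n d q i j * w j = prow d q n (ext0 w) i := by
  rw [← Lm_row n hn]
  simp only [ext0_fin]

lemma Lm_off (n : ℕ) (d q : ℝ) (hd : 0 < d) (hq : 0 < q) (i j : Fin n) (h : i ≠ j) :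
    0 ≤ Lm n d q i j := by
  have h' : (i : ℕ) ≠ j := fun e => h (Fin.ext e)
  simp only [Lm, Da, Qm, h, if_false]
  split_ifs <;> simp <;> positivity

lemma Lm_conn (n : ℕ) (d q : ℝ) (hd : 0 < d) (hq : 0 < q) (P : Fin n → Prop) (i0 : Fin n)
    (h0 : P i0) (hs : ∀ i j, i ≠ j → 0 < Lm n d q i j → P j → P i) : ∀ i, P i := by
  have hup : ∀ k (hk : k + 1 < n), P ⟨k, by omega⟩ → P ⟨k+1, hk⟩ := by
    intro k hk h
    refine hs _ _ (by simp) ?_ h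
    simp [Lm, Da, Qm]; positivity
  have hdn : ∀ k (hk : k + 1 < n), P ⟨k+1, hk⟩ → P ⟨k, by omega⟩ := by
    intro k hk h
    refine hs _ _ (by simp) ?_ h
    simp [Lm, Da, Qm]; positivity
  obtain ⟨m, hm⟩ := i0
  have hz : ∀ k (hk : k < n), P ⟨k, hk⟩ → P ⟨0, by omega⟩ := by
    intro k
    induction k with
    | zero => exact fun _ h => h
    | succ k ih => exact fun hk h => ih (by omega) (hdn k hk h)
  have h00 := hz m hm h0
  rintro ⟨k, hk⟩
  induction k with
  | zero => exact h00
  | succ k ih => exact hup k hk (ih (by omega))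

lemma Lm_const (n : ℕ) (hn : 2 ≤ n) (d q M : ℝ) (hq : 0 < q) (hM : 0 ≤ M) (i : Fin n) :
    ∑ j : Fin n, Lm n d q i j * M ≤ 0 := by
  have := Lm_row n hn d q (fun _ => M) i
  rw [this]
  simp only [prow, sub_self, mul_zero]
  split_ifs <;> simp <;> positivity

lemma lemP (n : ℕ) (hn : 2 ≤ n) (r d₁ q₁ d₂ q₂ : ℝ) (hd1 : 0 < d₁) (hq1 : 0 < q₁)
    (hd2 : 0 < d₂) (hq2 : 0 < q₂) (U V : ℕ → ℝ) (hU : ∀ k < n, 0 ≤ U k) (hV : ∀ k < n, 0 ≤ V k)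
    (hUV : ∀ k < n, 0 < U k + V k)
    (eU : ∀ k < n, prow d₁ q₁ n U k + U k * (r - U k - V k) = 0)
    (eV : ∀ k < n, prow d₂ q₂ n V k + V k * (r - U k - V k) = 0) :
    ∀ k < n, 0 < r - U k - V k := by
  have stepneg : ∀ (d q : ℝ) (W p : ℕ → ℝ), 0 < d → 0 < q → (∀ k < n, 0 ≤ W k) →
      (∀ k < n, prow d q n W k + W k * p k = 0) → ∀ k, k + 1 < n → p (k+1) ≤ 0 →
      (if k + 1 + 1 < n then d * (W (k+1+1) - W (k+1)) else 0) ≤ 0 → W (k+1) ≤ W k := by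
    intro d q W p hd hq hW he k hk hp hf
    have h := he (k+1) hk
    simp only [prow, Nat.add_sub_cancel, Nat.succ_ne_zero, if_false] at h
    have h2 := mul_nonneg (hW (k+1) hk) (neg_nonneg.2 hp)
    have h3 : (d+q) * (W (k+1) - W k) ≤ 0 := by linarith
    by_contra hc
    have := mul_pos (add_pos hd hq) (sub_pos.2 (not_le.1 hc))
    linarith
  have steppos : ∀ (d q : ℝ) (W p : ℕ → ℝ), 0 < d → 0 < q → (∀ k < n, 0 ≤ W k) →
      (∀ k < n, prow d q n W k + W k * p k = 0) → ∀ k, k + 1 < n → 0 < p (k+1) →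
      0 ≤ (if k + 1 + 1 < n then d * (W (k+1+1) - W (k+1)) else 0) → W k ≤ W (k+1) := by
    intro d q W p hd hq hW he k hk hp hf
    have h := he (k+1) hk
    simp only [prow, Nat.add_sub_cancel, Nat.succ_ne_zero, if_false] at h
    have h2 := mul_nonneg (hW (k+1) hk) hp.le
    have h3 : 0 ≤ (d+q) * (W (k+1) - W k) := by linarith
    by_contra hc
    have := mul_pos (add_pos hd hq) (sub_pos.2 (not_le.1 hc))
    linarith
  set p : ℕ → ℝ := fun k => r - U k - V k with hp
  have hlast : 0 < p (n-1) := by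
    by_contra hc
    have hall : ∀ j < n, p (n-1-j) ≤ 0 ∧
        (if n-1-j + 1 < n then d₁ * (U (n-1-j+1) - U (n-1-j)) else 0) ≤ 0 ∧
        (if n-1-j + 1 < n then d₂ * (V (n-1-j+1) - V (n-1-j)) else 0) ≤ 0 := by
      intro j
      induction j with
      | zero =>
        intro _
        refine ⟨by simpa using hc, ?_, ?_⟩ <;> rw [if_neg (by omega)]
      | succ j ih =>
        intro hj
        obtain ⟨h1, h2, h3⟩ := ih (by omega)
        obtain ⟨k, hk⟩ : ∃ k, k = n - 1 - (j+1) := ⟨_, rfl⟩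
        have hk' : n - 1 - j = k + 1 := by omega
        rw [hk'] at h1 h2 h3
        rw [← hk]
        have a1 := stepneg d₁ q₁ U p hd1 hq1 hU eU k (by omega) h1 h2
        have a2 := stepneg d₂ q₂ V p hd2 hq2 hV eV k (by omega) h1 h3
        refine ⟨by simp only [hp] at h1 ⊢; linarith, ?_, ?_⟩ <;> rw [if_pos (by omega)] <;> nlinarith
    obtain ⟨h1, h2, h3⟩ := hall (n-1) (by omega)
    have z : n - 1 - (n - 1) = 0 := by omega
    rw [z] at h1 h2 h3
    have e1 := eU 0 (by omega)
    have e2 := eV 0 (by omega)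
    simp only [prow, if_true] at e1 e2
    have := mul_nonneg (hU 0 (by omega)) (neg_nonneg.2 h1)
    have := mul_nonneg (hV 0 (by omega)) (neg_nonneg.2 h1)
    simp only [hp] at *
    have := mul_nonneg hq1.le (hU 0 (by omega))
    have := mul_nonneg hq2.le (hV 0 (by omega))
    have b1 : q₁ * U 0 = 0 := by linarith
    have b2 : q₂ * V 0 = 0 := by linarith
    have := hUV 0 (by omega)
    have c1 : U 0 = 0 := by simpa [hq1.ne'] using b1
    have c2 : V 0 = 0 := by simpa [hq2.ne'] using b2
    linarith
  have hall : ∀ j < n, 0 < p (n-1-j) ∧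
      0 ≤ (if n-1-j + 1 < n then d₁ * (U (n-1-j+1) - U (n-1-j)) else 0) ∧
      0 ≤ (if n-1-j + 1 < n then d₂ * (V (n-1-j+1) - V (n-1-j)) else 0) := by
    intro j
    induction j with
    | zero =>
      intro _
      refine ⟨by simpa using hlast, ?_, ?_⟩ <;> rw [if_neg (by omega)]
    | succ j ih =>
      intro hj
      obtain ⟨h1, h2, h3⟩ := ih (by omega)
      obtain ⟨k, hk⟩ : ∃ k, k = n - 1 - (j+1) := ⟨_, rfl⟩
      have hk' : n - 1 - j = k + 1 := by omega
      rw [hk'] at h1 h2 h3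
      rw [← hk]
      have a1 := steppos d₁ q₁ U p hd1 hq1 hU eU k (by omega) h1 h2
      have a2 := steppos d₂ q₂ V p hd2 hq2 hV eV k (by omega) h1 h3
      refine ⟨by simp only [hp] at h1 ⊢; linarith, ?_, ?_⟩ <;> rw [if_pos (by omega)] <;> nlinarith
  intro k hk
  have := (hall (n-1-k) (by omega)).1
  rwa [show n - 1 - (n - 1 - k) = k by omega] at this

lemma lemPhi (n : ℕ) (hn : 2 ≤ n) (d₁ q₁ d₂ q₂ : ℝ) (hd1 : 0 < d₁) (hq1 : 0 < q₁)
    (hd2 : 0 < d₂) (hq2 : 0 < q₂) (hG1 : d₂ ≤ d₁ / q₁ * q₂) (hG2 : q₁ ≤ q₂)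
    (hG3 : (d₂, q₂) ≠ (d₁, q₁)) (W p : ℕ → ℝ) (hW : ∀ k < n, 0 < W k) (hp : ∀ k < n, 0 < p k)
    (e : ∀ k < n, prow d₂ q₂ n W k + W k * p k = 0) :
    ∃ Φ : ℕ → ℝ, (∀ k, 0 < Φ k) ∧ ∀ k < n, 0 < prow d₁ q₁ n Φ k + Φ k * p k := by
  obtain ⟨E, hE⟩ : ∃ E : ℕ → ℝ, ∀ k, E k = if k + 1 < n then d₂ * (W (k+1) / W k - 1) else 0 :=
    ⟨_, fun _ => rfl⟩
  have hEW : ∀ k < n, (if k + 1 < n then d₂ * (W (k+1) - W k) else 0) = E k * W k := by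
    intro k hk
    have := hW k hk
    rw [hE]; split_ifs
    · field_simp
    · simp
  have hE0 : ∀ j < n, 0 ≤ E (n-1-j) ∧ (0 < j → 0 < E (n-1-j)) := by
    intro j
    induction j with
    | zero =>
      intro _
      rw [hE, if_neg (by omega)]; simp
    | succ j ih =>
      intro hj
      have h1 := (ih (by omega)).1
      obtain ⟨k, hk⟩ : ∃ k, k = n - 1 - (j+1) := ⟨_, rfl⟩
      have hk' : n - 1 - j = k + 1 := by omega
      rw [hk'] at h1
      rw [← hk]
      have h := e (k+1) (by omega)
      simp only [prow, Nat.add_sub_cancel, Nat.succ_ne_zero, if_false] at h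
      rw [hEW (k+1) (by omega)] at h
      have w1 := hW (k+1) (by omega)
      have w0 := hW k (by omega)
      have h2 := mul_pos w1 (hp (k+1) (by omega))
      have h3 := mul_nonneg h1 w1.le
      have h4 : 0 < (d₂+q₂) * (W (k+1) - W k) := by linarith
      have h5 : 0 < W (k+1) - W k := by
        by_contra hc
        have := mul_nonneg (add_pos hd2 hq2).le (neg_nonneg.2 (not_lt.1 hc))
        linarith
      have h6 : 0 < E k * W k := by
        rw [← hEW k (by omega), if_pos (by omega)]; positivity
      have h7 : 0 < E k := by
        by_contra hc
        have := mul_nonneg (neg_nonneg.2 (not_lt.1 hc)) w0.le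
        linarith
      exact ⟨h7.le, fun _ => h7⟩
  have hEpos : ∀ k, k + 1 < n → 0 < E k := by
    intro k hk
    have := (hE0 (n-1-k) (by omega)).2 (by omega)
    rwa [show n - 1 - (n - 1 - k) = k by omega] at this
  have hEnn : ∀ k, 0 ≤ E k := by
    intro k
    by_cases hk : k + 1 < n
    · exact (hEpos k hk).le
    · rw [hE, if_neg hk]
  have hEq : ∀ k < n, E k < q₂ := by
    intro k
    induction k with
    | zero =>
      intro hk
      have h := e 0 hk
      simp only [prow, if_true] at h
      rw [hEW 0 hk] at h
      have w0 := hW 0 hk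
      have h2 := mul_pos w0 (hp 0 hk)
      have : E 0 * W 0 < q₂ * W 0 := by linarith
      exact lt_of_mul_lt_mul_right this w0.le
    | succ k ih =>
      intro hk
      have h := e (k+1) hk
      simp only [prow, Nat.add_sub_cancel, Nat.succ_ne_zero, if_false] at h
      rw [hEW (k+1) hk] at h
      have h8 := hEW k (by omega)
      rw [if_pos hk] at h8
      have w0 := hW k (by omega)
      have w1 := hW (k+1) hk
      have h2 := mul_pos w1 (hp (k+1) hk)
      have h3 := mul_lt_mul_of_pos_right (ih (by omega)) w0
      have : E (k+1) * W (k+1) < q₂ * W (k+1) := by nlinarith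
      exact lt_of_mul_lt_mul_right this w1.le
  obtain ⟨τ, hτ⟩ : ∃ τ, τ = q₂ / q₁ := ⟨_, rfl⟩
  have hτ1 : 1 ≤ τ := by rw [hτ, le_div_iff₀ hq1]; linarith
  have hτ0 : 0 < τ := by linarith
  have hτq : τ * q₁ = q₂ := by rw [hτ]; field_simp
  have hd' : d₂ ≤ τ * d₁ := by
    rw [hτ]; calc d₂ ≤ d₁ / q₁ * q₂ := hG1
      _ = _ := by ring
  have hstr : 1 < τ ∨ d₂ < τ * d₁ := by
    by_contra hc
    push Not at hc
    have h1 : τ = 1 := le_antisymm hc.1 hτ1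
    apply hG3
    rw [h1] at hτq hd' hc
    ext <;> simp <;> linarith [hc.2]
  obtain ⟨D, hD⟩ : ∃ D, D = τ * d₁ := ⟨_, rfl⟩
  have hDpos : 0 < D := by rw [hD]; positivity
  rw [← hD] at hd' hstr
  obtain ⟨F, hF⟩ : ∃ F : ℕ → ℝ, ∀ k, F k = ∏ j ∈ Finset.range k, (1 + E j / D) := ⟨_, fun _ => rfl⟩
  have hFpos : ∀ k, 0 < F k := by
    intro k; rw [hF]
    apply Finset.prod_pos
    intro j _
    have := hEnn j
    positivity
  have hFs : ∀ k, F (k+1) = F k * (1 + E k / D) := by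
    intro k; rw [hF, hF, Finset.prod_range_succ]
  have hft : ∀ k, τ * (if k + 1 < n then d₁ * (F (k+1) - F k) else 0) = E k * F k := by
    intro k
    split_ifs with h
    · rw [hFs, ← mul_assoc, ← hD]; field_simp; ring
    · rw [hE, if_neg h]; simp
  have r0 : 0 ≤ prow d₁ q₁ n F 0 + F 0 * p 0 := by
    have h := e 0 (by omega)
    simp only [prow, if_true] at h ⊢
    rw [hEW 0 (by omega)] at h
    have w0 := hW 0 (by omega)
    have h9 : E 0 - q₂ + p 0 = 0 := by
      have : (E 0 - q₂ + p 0) * W 0 = 0 := by linarith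
      rcases mul_eq_zero.1 this with h | h
      · exact h
      · linarith
    have h10 := hft 0
    have h11 : 0 ≤ τ * ((if 0 + 1 < n then d₁ * (F (0+1) - F 0) else 0) - q₁ * F 0 + F 0 * p 0) := by
      have : τ * ((if 0 + 1 < n then d₁ * (F (0+1) - F 0) else 0) - q₁ * F 0 + F 0 * p 0)
        = F 0 * (E 0 - q₂ + p 0) + (τ - 1) * (F 0 * p 0) := by
        rw [mul_add, mul_sub, h10, ← hτq]; ring
      rw [this, h9, mul_zero, zero_add]
      exact mul_nonneg (by linarith) (mul_pos (hFpos 0) (hp 0 (by omega))).le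
    exact nonneg_of_mul_nonneg_right h11 hτ0
  have rk : ∀ k, k + 1 < n → 0 < prow d₁ q₁ n F (k+1) + F (k+1) * p (k+1) := by
    intro k hk
    have h := e (k+1) hk
    simp only [prow, Nat.add_sub_cancel, Nat.succ_ne_zero, if_false] at h ⊢
    rw [hEW (k+1) hk] at h
    have h8 := hEW k (by omega)
    rw [if_pos hk] at h8
    have w0 := hW k (by omega)
    have w1 := hW (k+1) hk
    have ek := hEpos k hk
    have ekq := hEq k (by omega)
    have hWs : d₂ * W (k+1) = (d₂ + E k) * W k := by linarith
    have h9 : E (k+1) - (d₂ + q₂) * E k / (d₂ + E k) + p (k+1) = 0 := by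
      have hne : d₂ + E k ≠ 0 := by positivity
      have : (E (k+1) - (d₂ + q₂) * E k / (d₂ + E k) + p (k+1)) * W (k+1) = 0 := by
        have hh : E k / (d₂ + E k) * W (k+1) = W (k+1) - W k := by
          field_simp; nlinarith
        linear_combination h - (d₂ + q₂) * hh
      rcases mul_eq_zero.1 this with h | h
      · exact h
      · linarith
    have hFsk : D * F (k+1) = (D + E k) * F k := by rw [hFs]; field_simp
    have hh : E k / (D + E k) * F (k+1) = F (k+1) - F k := by
      have hne : D + E k ≠ 0 := by positivity
      field_simp; nlinarith
    have h10 := hft (k+1)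
    have key : (D + q₂) * E k / (D + E k) ≤ (d₂ + q₂) * E k / (d₂ + E k) ∧
       (d₂ < D → (D + q₂) * E k / (D + E k) < (d₂ + q₂) * E k / (d₂ + E k)) := by
      have id : (d₂ + q₂) * E k / (d₂ + E k) - (D + q₂) * E k / (D + E k)
         = E k * ((D - d₂) * (q₂ - E k)) / ((d₂ + E k) * (D + E k)) := by
        field_simp; ring
      constructor
      · rw [← sub_nonneg, id]
        have := mul_nonneg (sub_nonneg.2 hd') (sub_pos.2 ekq).le
        positivity
      · intro hlt
        rw [← sub_pos, id]
        have := mul_pos (sub_pos.2 hlt) (sub_pos.2 ekq)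
        positivity
    have h11 : 0 < τ * ((if k + 1 + 1 < n then d₁ * (F (k+1+1) - F (k+1)) else 0)
        - (d₁ + q₁) * (F (k+1) - F k) + F (k+1) * p (k+1)) := by
      have : τ * ((if k + 1 + 1 < n then d₁ * (F (k+1+1) - F (k+1)) else 0)
        - (d₁ + q₁) * (F (k+1) - F k) + F (k+1) * p (k+1))
        = F (k+1) * ((d₂ + q₂) * E k / (d₂ + E k) - (D + q₂) * E k / (D + E k))
          + (τ - 1) * (F (k+1) * p (k+1)) := by
        have h12 : (d₂ + q₂) * E k / (d₂ + E k) = E (k+1) + p (k+1) := by linarith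
        rw [mul_add, mul_sub, h10, h12]
        have : τ * ((d₁ + q₁) * (F (k+1) - F k)) = (D + q₂) * (E k / (D + E k) * F (k+1)) := by
          rw [hh, hD, ← hτq]; ring
        rw [this]; ring
      rw [this]
      have fp := hFpos (k+1)
      have pp := mul_pos fp (hp (k+1) hk)
      rcases hstr with hs | hs
      · exact add_pos_of_nonneg_of_pos (mul_nonneg fp.le (sub_nonneg.2 key.1))
          (mul_pos (sub_pos.2 hs) pp)
      · exact add_pos_of_pos_of_nonneg (mul_pos fp (sub_pos.2 (key.2 hs)))
          (mul_nonneg (by linarith) pp.le)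
    exact (mul_pos_iff_of_pos_left hτ0).1 h11
  -- perturb at 0
  have r1 := rk 0 (by omega)
  obtain ⟨ρ, hρ⟩ : ∃ ρ, ρ = prow d₁ q₁ n F (0+1) + F (0+1) * p (0+1) := ⟨_, rfl⟩
  rw [← hρ] at r1
  have hF0 := hFpos 0
  have hcc : 0 < (d₁ + q₁) * F 0 := by positivity
  obtain ⟨ε, hε0, hε1, hε2⟩ : ∃ ε : ℝ, 0 < ε ∧ ε < 1 ∧ ε * ((d₁ + q₁) * F 0) < ρ := by
    refine ⟨min (1/2) (ρ / (2 * ((d₁ + q₁) * F 0))), by positivity,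
      lt_of_le_of_lt (min_le_left _ _) (by norm_num), ?_⟩
    calc _ ≤ ρ / (2 * ((d₁ + q₁) * F 0)) * ((d₁ + q₁) * F 0) :=
          mul_le_mul_of_nonneg_right (min_le_right _ _) hcc.le
      _ = ρ / 2 := by field_simp
      _ < ρ := by linarith
  refine ⟨fun k => if k = 0 then (1 - ε) * F 0 else F k, ?_, ?_⟩
  · intro k
    dsimp only
    split_ifs
    · exact mul_pos (by linarith) hF0
    · exact hFpos k
  · intro k hk
    match k, hk with
    | 0, hk =>
      have h1 : 0 < F 1 := hFpos 1
      simp only [prow, if_true, zero_add, show 1 < n by omega, one_ne_zero, if_false] at r0 ⊢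
      have a1 := mul_nonneg (show (0:ℝ) ≤ 1 - ε by linarith) r0
      have a2 := mul_pos hε0 (mul_pos hd1 h1)
      nlinarith
    | 1, hk =>
      simp only [prow, zero_add, one_ne_zero, if_false, Nat.sub_self, if_true,
        show 1 + 1 ≠ 0 by omega] at hρ ⊢
      linarith
    | k+2, hk =>
      have := rk (k+1) hk
      simp only [prow, show k + 2 + 1 ≠ 0 by omega, show k + 2 ≠ 0 by omega,
        show k + 2 - 1 = k + 1 by omega, show k + 1 + 1 = k + 2 by omega, if_false,
        show k + 1 ≠ 0 by omega] at this ⊢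
      exact this


/-- quasi-monotone vector fields -/
def QMon {ι : Type} (F : (ι → ℝ) → ι → ℝ) : Prop :=
  ∀ i x y, x ≤ y → x i = y i → F x i ≤ F y i

lemma exists_zero {ι : Type} [Fintype ι] [DecidableEq ι] (F : (ι → ℝ) → ι → ℝ) (hF : Continuous F)
    (hQ : QMon F) (a b : ι → ℝ) (hab : a ≤ b) (ha : 0 ≤ F a) (hb : F b ≤ 0) :
    ∃ x, a ≤ x ∧ x ≤ b ∧ F x = 0 := by
  have hc : IsCompact (Set.Icc a b ∩ {x | F x ≤ 0}) :=
    isCompact_Icc.inter_right (isClosed_le hF continuous_const)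
  have hs : Continuous (fun x : ι → ℝ => ∑ i, x i) := by fun_prop
  obtain ⟨x, ⟨⟨hax, hxb⟩, hx⟩, hmin⟩ := hc.exists_isMinOn ⟨b, ⟨⟨hab, le_refl b⟩, hb⟩⟩ hs.continuousOn
  refine ⟨x, hax, hxb, ?_⟩
  by_contra hne
  obtain ⟨i, hi⟩ : ∃ i, F x i < 0 := by
    by_contra hcon
    push Not at hcon
    exact hne (le_antisymm hx hcon)
  have hai : a i < x i := by
    rcases (hax i).lt_or_eq with h | h
    · exact h
    · have := hQ i a x hax h
      have h2 := ha i
      simp at h2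
      linarith
  have hcont : Tendsto (fun s : ℝ => F (Function.update x i s) i) (nhds (x i)) (nhds (F x i)) := by
    have : Continuous (fun s : ℝ => F (Function.update x i s) i) := by
      have h1 : Continuous (fun s : ℝ => Function.update x i s) := continuous_const.update i continuous_id
      exact (continuous_apply i).comp (hF.comp h1)
    have := this.tendsto (x i)
    simpa using this
  have hev := (hcont.eventually_lt_const hi).filter_mono (nhdsWithin_le_nhds (s := Set.Iio (x i)))
  have hev2 : ∀ᶠ s in nhdsWithin (x i) (Set.Iio (x i)), a i < s :=
    (lt_mem_nhds hai).filter_mono nhdsWithin_le_nhds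
  obtain ⟨s, ⟨hs1, hs2⟩, hs3⟩ := ((hev.and hev2).and self_mem_nhdsWithin).exists
  have hle : Function.update x i s ≤ x := by
    intro j
    by_cases hj : j = i
    · subst hj; simpa using (le_of_lt hs3)
    · simp [hj]
  have hmem : Function.update x i s ∈ Set.Icc a b ∩ {x | F x ≤ 0} := by
    refine ⟨⟨?_, hle.trans hxb⟩, ?_⟩
    · intro j
      by_cases hj : j = i
      · subst hj; simpa using hs2.le
      · simpa [hj] using hax j
    · intro j
      by_cases hj : j = i
      · subst hj; exact hs1.le
      · exact (hQ j _ _ hle (by simp [hj])).trans (hx j)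
  have h1 := hmin hmem
  simp only [Set.mem_ofPred_eq] at h1
  have h2 : ∑ j, Function.update x i s j < ∑ j, x j :=
    Finset.sum_lt_sum (fun j _ => hle j) ⟨i, Finset.mem_univ _, by simpa using hs3⟩
  linarith

lemma QM_sum {ι : Type} [Fintype ι] [DecidableEq ι] (A : ι → ι → ℝ)
    (hA : ∀ i j, i ≠ j → 0 ≤ A i j)
    (i : ι) (x y : ι → ℝ) (h : x ≤ y) (he : x i = y i) : ∑ j, A i j * x j ≤ ∑ j, A i j * y j := by
  apply Finset.sum_le_sum
  intro j _
  by_cases hj : i = j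
  · subst hj; rw [he]
  · exact mul_le_mul_of_nonneg_left (h j) (hA i j hj)

/-- touching: positive `w`, any `x`: there is `s` with `x ≤ s w` and equality at one index -/
lemma touch_above {ι : Type} [Fintype ι] [Nonempty ι] (w x : ι → ℝ) (hw : ∀ i, 0 < w i) :
    ∃ s : ℝ, ∃ k, (∀ i, x i ≤ s * w i) ∧ x k = s * w k := by
  obtain ⟨k, hk⟩ := Finite.exists_max (fun i => x i / w i)
  refine ⟨x k / w k, k, fun i => ?_, ?_⟩
  · rw [← div_le_iff₀ (hw i)]; exact hk i
  · rw [div_mul_cancel₀ _ (hw k).ne']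

lemma sub_le_super {ι : Type} [Fintype ι] [DecidableEq ι] (A : ι → ι → ℝ)
    (hA : ∀ i j, i ≠ j → 0 ≤ A i j) (r : ℝ) (x w : ι → ℝ) (hx : ∀ i, 0 ≤ x i) (hw : ∀ i, 0 < w i)
    (hxs : ∀ i, 0 ≤ ∑ j, A i j * x j + x i * (r - x i))
    (hws : ∀ i, ∑ j, A i j * w j + w i * (r - w i) ≤ 0) : ∀ i, x i ≤ w i := by
  intro i0
  have : Nonempty ι := ⟨i0⟩
  obtain ⟨s, k, h1, h2⟩ := touch_above w x hw
  suffices hs : s ≤ 1 by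
    have := h1 i0
    nlinarith [hw i0]
  by_contra hs
  push Not at hs
  have h3 := QM_sum A hA k x (fun i => s * w i) h1 h2
  have h4 : ∑ j, A k j * (s * w j) = s * ∑ j, A k j * w j := by
    rw [Finset.mul_sum]; apply Finset.sum_congr rfl; intros; ring
  have h5 := hxs k
  have h6 := mul_le_mul_of_nonneg_left (hws k) (show (0:ℝ) ≤ s by linarith)
  have hwk := hw k
  rw [h2] at h5
  have h7 : s * w k * (s * w k) ≤ s * w k * w k := by nlinarith
  have h8 : 0 < s * w k := by positivity
  have h9 : s * w k ≤ w k := le_of_mul_le_mul_left h7 h8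
  nlinarith

/-- strict subsolution `φ` and nonneg positive supersolution cannot coexist (linear) -/
lemma no_strict {ι : Type} [Fintype ι] [DecidableEq ι] [Nonempty ι] (A : ι → ι → ℝ)
    (hA : ∀ i j, i ≠ j → 0 ≤ A i j) (p : ι → ℝ) (φ w : ι → ℝ) (hφ : ∀ i, 0 < φ i) (hw : ∀ i, 0 < w i)
    (hφs : ∀ i, 0 < ∑ j, A i j * φ j + φ i * p i)
    (hws : ∀ i, ∑ j, A i j * w j + w i * p i = 0) : False := by
  obtain ⟨s, k, h1, h2⟩ := touch_above w φ hw
  have h3 := QM_sum A hA k φ (fun i => s * w i) h1 h2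
  have h4 : ∑ j, A k j * (s * w j) = s * ∑ j, A k j * w j := by
    rw [Finset.mul_sum]; apply Finset.sum_congr rfl; intros; ring
  have h5 := hφs k
  have h6 := hws k
  rw [h2] at h5
  have : s * (∑ j, A k j * w j + w k * p k) = 0 := by rw [h6, mul_zero]
  linarith

/-- comparison principle -/
lemma comparison {ι : Type} [Fintype ι] [DecidableEq ι] (A : ι → ι → ℝ)
    (hA : ∀ i j, i ≠ j → 0 ≤ A i j) (T : ℝ) (z zd c : ℝ → ι → ℝ)
    (hz : ∀ i t, T ≤ t → HasDerivAt (fun s => z s i) (zd t i) t)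
    (hc : ∀ i, ContinuousOn (fun t => c t i) (Set.Ici T))
    (hineq : ∀ i t, T ≤ t → ∑ j, A i j * z t j + c t i * z t i ≤ zd t i)
    (h0 : ∀ i, 0 ≤ z T i) : ∀ t, T ≤ t → ∀ i, 0 ≤ z t i := by
  intro t0 ht0
  have hbd : ∀ i, ∃ C, ∀ t ∈ Set.Icc T t0, c t i ≤ C := by
    intro i
    obtain ⟨C, hC⟩ := (isCompact_Icc (a := T) (b := t0)).exists_bound_of_continuousOn
      ((hc i).mono Set.Icc_subset_Ici_self)
    exact ⟨C, fun t ht => (le_abs_self _).trans (hC t ht)⟩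
  choose C hC using hbd
  set m : ℝ → ι → ℝ := fun t i => min (z t i) 0 with hm
  set y : ℝ → ℝ := fun t => ∑ i, (m t i)^2 with hy
  set K : ℝ := ∑ i, (∑ j, 2 * |A i j| + 2 * |C i|) with hK
  have hsq : ∀ x : ℝ, HasDerivAt (fun x : ℝ => (min x 0)^2) (2 * min x 0) x := by
    intro x
    rcases lt_trichotomy x 0 with h | h | h
    · have : HasDerivAt (fun x : ℝ => x^2) (2 * x) x := by simpa using hasDerivAt_pow 2 x
      rw [min_eq_left h.le]
      refine this.congr_of_eventuallyEq ?_
      filter_upwards [gt_mem_nhds h] with w hw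
      rw [min_eq_left hw.le]
    · subst h
      simp only [min_self, mul_zero]
      rw [hasDerivAt_iff_isLittleO]
      simp only [min_self, ne_eq, OfNat.ofNat_ne_zero, not_false_eq_true, zero_pow, sub_zero, smul_zero]
      have h1 : (fun x : ℝ => (min x 0)^2) =O[nhds 0] (fun x : ℝ => x^2) := by
        apply Asymptotics.IsBigO.of_bound 1
        filter_upwards with w
        simp only [norm_pow, one_mul]
        gcongr
        simp only [Real.norm_eq_abs]
        rcases le_total w 0 with h | h
        · rw [min_eq_left h]
        · rw [min_eq_right h]; simp
      refine h1.trans_isLittleO ?_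
      have := Asymptotics.isLittleO_pow_id (𝕜 := ℝ) (n := 2) (by norm_num)
      simpa using this
    · have : HasDerivAt (fun _ : ℝ => (0:ℝ)) 0 x := hasDerivAt_const x 0
      rw [min_eq_right h.le, mul_zero]
      refine this.congr_of_eventuallyEq ?_
      filter_upwards [lt_mem_nhds h] with w hw
      rw [min_eq_right hw.le]; simp
  have hyd : ∀ t, T ≤ t → HasDerivAt y (∑ i, 2 * m t i * zd t i) t := by
    intro t ht
    have : HasDerivAt (fun t => ∑ i, (m t i)^2) (∑ i, 2 * m t i * zd t i) t := by
      apply HasDerivAt.fun_sum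
      intro i _
      exact (hsq (z t i)).comp t (hz i t ht)
    exact this
  have hyle : ∀ t ∈ Set.Icc T t0, ∑ i, 2 * m t i * zd t i ≤ K * y t := by
    intro t ht
    have hmle : ∀ i, m t i ≤ 0 := fun i => min_le_right _ _
    have hmz : ∀ i, m t i ≤ z t i := fun i => min_le_left _ _
    have hmm : ∀ i, m t i * z t i = (m t i)^2 := by
      intro i
      simp only [hm]
      rcases le_total (z t i) 0 with h | h
      · rw [min_eq_left h]; ring
      · rw [min_eq_right h]; ring
    have hmy : ∀ i, (m t i)^2 ≤ y t := by
      intro i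
      exact Finset.single_le_sum (f := fun i => (m t i)^2) (fun j _ => sq_nonneg _) (Finset.mem_univ i)
    have hy0 : 0 ≤ y t := Finset.sum_nonneg (fun j _ => sq_nonneg _)
    rw [hK, Finset.sum_mul]
    apply Finset.sum_le_sum
    intro i _
    have h1 : 2 * m t i * zd t i ≤ 2 * m t i * (∑ j, A i j * z t j + c t i * z t i) := by
      have := mul_le_mul_of_nonneg_left (hineq i t ht.1) (show 0 ≤ -(2 * m t i) by linarith [hmle i])
      linarith
    have h2 : 2 * m t i * (c t i * z t i) ≤ 2 * |C i| * y t := by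
      have : 2 * m t i * (c t i * z t i) = 2 * c t i * (m t i)^2 := by rw [← hmm]; ring
      rw [this]
      have h3 : c t i ≤ |C i| := (hC i t ht).trans (le_abs_self _)
      have h4 := mul_le_mul_of_nonneg_right h3 (sq_nonneg (m t i))
      have h5 := mul_le_mul_of_nonneg_left (hmy i) (abs_nonneg (C i))
      linarith
    have h3 : 2 * m t i * (∑ j, A i j * z t j) ≤ (∑ j, 2 * |A i j|) * y t := by
      rw [Finset.mul_sum, Finset.sum_mul]
      apply Finset.sum_le_sum
      intro j _
      have h6 : m t i * m t j ≤ y t := by nlinarith [sq_nonneg (m t i - m t j), hmy i, hmy j]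
      have h7 : 2 * m t i * (A i j * z t j) ≤ 2 * A i j * (m t i * m t j) := by
        by_cases hij : i = j
        · subst hij
          have := hmm i
          apply le_of_eq
          linear_combination 2 * A i i * this
        · have h8 := mul_le_mul_of_nonneg_left (hmz j) (show 0 ≤ -(m t i) by linarith [hmle i])
          have h9 := mul_le_mul_of_nonneg_left h8 (hA i j hij)
          linarith
      have h10 : 0 ≤ m t i * m t j := mul_nonneg_of_nonpos_of_nonpos (hmle i) (hmle j)
      have h11 := mul_le_mul_of_nonneg_right (le_abs_self (A i j)) h10
      have h12 := mul_le_mul_of_nonneg_left h6 (abs_nonneg (A i j))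
      linarith
    linarith
  have hanti : AntitoneOn (fun t => Real.exp (-K * t) * y t) (Set.Icc T t0) := by
    have hder : ∀ t, T ≤ t → HasDerivAt (fun t => Real.exp (-K * t) * y t)
        (Real.exp (-K * t) * (-K) * y t + Real.exp (-K * t) * (∑ i, 2 * m t i * zd t i)) t := by
      intro t ht
      have h1 : HasDerivAt (fun t => Real.exp (-K * t)) (Real.exp (-K * t) * (-K)) t := by
        have := ((hasDerivAt_id t).const_mul (-K)).exp
        simpa using this
      exact h1.mul (hyd t ht)
    apply antitoneOn_of_deriv_nonpos (convex_Icc _ _)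
    · intro t ht
      exact (hder t ht.1).continuousAt.continuousWithinAt
    · intro t ht
      rw [interior_Icc] at ht
      exact (hder t ht.1.le).differentiableAt.differentiableWithinAt
    · intro t ht
      rw [interior_Icc] at ht
      rw [(hder t ht.1.le).deriv]
      have := mul_le_mul_of_nonneg_left (hyle t ⟨ht.1.le, ht.2.le⟩) (Real.exp_pos (-K * t)).le
      linarith
  have hyT : y T = 0 := by
    apply Finset.sum_eq_zero
    intro i _
    simp [hm, h0 i]
  have h1 := hanti (Set.left_mem_Icc.2 ht0) (Set.right_mem_Icc.2 ht0) ht0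
  simp only [hyT, mul_zero] at h1
  have h2 : y t0 ≤ 0 := by
    by_contra hcon
    have := mul_pos (Real.exp_pos (-K * t0)) (not_le.1 hcon)
    linarith
  intro i
  by_contra hcon
  push Not at hcon
  have h3 : (m t0 i)^2 ≤ y t0 :=
    Finset.single_le_sum (f := fun i => (m t0 i)^2) (fun j _ => sq_nonneg _) (Finset.mem_univ i)
  have h4 : m t0 i = z t0 i := min_eq_left hcon.le
  rw [h4] at h3
  nlinarith

/-- `m` is the liminf at infinity of `f` -/
def IsLI (f : ℝ → ℝ) (m : ℝ) : Prop :=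
  (∀ ε > 0, ∀ᶠ t in atTop, m - ε < f t) ∧ (∀ ε > 0, ∃ᶠ t in atTop, f t < m + ε)

lemma exists_LI (f : ℝ → ℝ) (a b : ℝ) (h : ∀ t, 0 ≤ t → a ≤ f t ∧ f t ≤ b) : ∃ m, IsLI f m := by
  have hev : ∀ᶠ t in atTop, a ≤ f t ∧ f t ≤ b := by
    filter_upwards [eventually_ge_atTop 0] with t ht using h t ht
  have hb : IsBoundedUnder (· ≥ ·) atTop f := ⟨a, by
    rw [eventually_map]; filter_upwards [hev] with t ht using ht.1⟩
  have hb2 : IsBoundedUnder (· ≤ ·) atTop f := ⟨b, by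
    rw [eventually_map]; filter_upwards [hev] with t ht using ht.2⟩
  refine ⟨liminf f atTop, ?_, ?_⟩
  · intro ε hε
    exact eventually_lt_of_lt_liminf (by linarith) hb
  · intro ε hε
    exact frequently_lt_of_liminf_lt hb2.isCoboundedUnder_ge (by linarith)

lemma LI_ge {f : ℝ → ℝ} {m a T : ℝ} (hm : IsLI f m) (h : ∀ t, T ≤ t → a ≤ f t) : a ≤ m := by
  by_contra hc
  push Not at hc
  obtain ⟨t, h1, h2⟩ := ((hm.2 (a - m) (by linarith)).and_eventually (eventually_ge_atTop T)).exists
  linarith [h t h2]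

lemma LI_le {f : ℝ → ℝ} {m b T : ℝ} (hm : IsLI f m) (h : ∀ t, T ≤ t → f t ≤ b) : m ≤ b := by
  by_contra hc
  push Not at hc
  obtain ⟨t, h1, h2⟩ := ((hm.1 (m - b) (by linarith)).and (eventually_ge_atTop T)).exists
  linarith [h t h2]

lemma LI_deriv (f fd : ℝ → ℝ) (m : ℝ) (hf : ∀ t, 0 ≤ t → HasDerivAt f (fd t) t) (hm : IsLI f m)
    (η δ : ℝ) (hη : 0 < η) (hδ : 0 < δ) (h : ∀ᶠ t in atTop, f t < m + η → δ ≤ fd t) : False := by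
  obtain ⟨T, hT⟩ := eventually_atTop.1 (h.and ((hm.1 η hη).and (eventually_ge_atTop 0)))
  have hT0 : 0 ≤ T := (hT T le_rfl).2.2
  set c : ℝ := 2 * η with hcdef
  set κ : ℝ := δ / (2 * c) with hκ
  have hc : 0 < c := by positivity
  have hκ0 : 0 < κ := by positivity
  have hck : c * κ = δ / 2 := by rw [hκ]; field_simp
  set B : ℝ → ℝ := fun t => m + η / 2 - c * Real.exp (-κ * (t - T)) with hB
  have hBd : ∀ t, HasDerivAt B (c * κ * Real.exp (-κ * (t - T))) t := by
    intro t
    have h1 : HasDerivAt (fun t => Real.exp (-κ * (t - T))) (Real.exp (-κ * (t - T)) * (-κ * 1)) t := by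
      exact (((hasDerivAt_id t).sub_const T).const_mul (-κ)).exp
    have h2 := (h1.const_mul c).const_sub (m + η/2)
    exact h2.congr_deriv (by ring)
  have hfence : ∀ b, T ≤ b → B b ≤ f b := by
    intro b hb
    have := image_le_of_deriv_right_lt_deriv_boundary (f := fun t => - f t) (f' := fun t => - fd t)
      (a := T) (b := b) (B := fun t => - B t) (B' := fun t => -(c * κ * Real.exp (-κ * (t - T))))
      (fun t ht => (hf t (hT0.trans ht.1)).neg.continuousAt.continuousWithinAt)
      (fun t ht => (hf t (hT0.trans ht.1)).neg.hasDerivWithinAt)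
      (by
        simp only [hB, sub_self, mul_zero, Real.exp_zero, mul_one]
        have := (hT T le_rfl).2.1
        linarith)
      (fun t => (hBd t).neg)
      (by
        intro t ht heq
        have h1 : f t = B t := by linarith
        have hep := Real.exp_pos (-κ * (t - T))
        have h2 : f t < m + η := by
          rw [h1]; simp only [hB]
          have := mul_pos hc hep
          linarith
        have h3 := (hT t ht.1).1 h2
        have h4 : Real.exp (-κ * (t - T)) ≤ 1 := by
          apply Real.exp_le_one_iff.2
          have := mul_nonneg hκ0.le (sub_nonneg.2 ht.1)
          linarith
        have h5 := mul_le_mul_of_nonneg_left h4 (mul_pos hc hκ0).le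
        linarith)
      (Set.right_mem_Icc.2 hb)
    linarith
  have hlim : Tendsto B atTop (nhds (m + η/2 - c * 0)) := by
    apply Tendsto.const_sub
    apply Tendsto.const_mul
    apply Real.tendsto_exp_atBot.comp
    have h1 : Tendsto (fun t : ℝ => t - T) atTop atTop := tendsto_atTop_add_const_right _ _ tendsto_id
    exact h1.const_mul_atTop_of_neg (by linarith)
  have h1 := hlim.eventually_const_lt (show m + η/4 < m + η/2 - c * 0 by linarith)
  obtain ⟨t, ht1, ht2, ht3⟩ :=
    ((hm.2 (η/4) (by linarith)).and_eventually (h1.and (eventually_ge_atTop T))).exists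
  linarith [hfence t ht3]

lemma fluct {ι : Type} [Fintype ι] (F : (ι → ℝ) → ι → ℝ) (hF : Continuous F)
    (hQ : QMon F) (y yd : ℝ → ι → ℝ)
    (hy : ∀ i t, 0 ≤ t → HasDerivAt (fun s => y s i) (yd t i) t)
    (hineq : ∀ i t, 0 ≤ t → F (y t) i ≤ yd t i)
    (m : ι → ℝ) (hm : ∀ i, IsLI (fun t => y t i) (m i)) : F m ≤ 0 := by
  classical
  intro i
  by_contra hcon
  simp only [Pi.zero_apply, not_le] at hcon
  have hcont : Continuous (fun x => F x i) := (continuous_apply i).comp hF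
  have h1 : ∀ᶠ x in nhds m, F m i / 2 < F x i := hcont.continuousAt.eventually_const_lt (by
    show F m i / 2 < F m i
    linarith)
  obtain ⟨η, hη, hball⟩ := Metric.eventually_nhds_iff.1 h1
  refine LI_deriv (fun t => y t i) (fun t => yd t i) (m i) (hy i) (hm i) η (F m i / 2) hη (by linarith) ?_
  have h2 : ∀ᶠ t in atTop, ∀ j, m j - η < y t j := by
    rw [eventually_all]
    exact fun j => (hm j).1 η hη
  filter_upwards [h2, eventually_ge_atTop 0] with t ht ht0 hlt
  set x : ι → ℝ := fun j => if j = i then y t j else min (y t j) (m j) with hx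
  have hxy : x ≤ y t := by
    intro j; simp only [hx]; split_ifs
    · exact le_rfl
    · exact min_le_left _ _
  have hxi : x i = y t i := by simp [hx]
  have hd : dist x m < η := by
    rw [dist_pi_lt_iff hη]
    intro j
    rw [Real.dist_eq, abs_lt]
    simp only [hx]
    have := ht j
    split_ifs with hj
    · subst hj; constructor <;> linarith
    · constructor
      · have : m j - η < min (y t j) (m j) := lt_min (ht j) (by linarith)
        linarith
      · have : min (y t j) (m j) ≤ m j := min_le_right _ _
        linarith
  have := hball hd
  have h3 := hQ i x (y t) hxy hxi
  have h4 := hineq i t ht0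
  linarith


def Fs {ι : Type} [Fintype ι] (A : ι → ι → ℝ) (r : ℝ) (y : ι → ℝ) (i : ι) : ℝ :=
  ∑ j, A i j * y j + y i * (r + y i)

lemma Fs_cont {ι : Type} [Fintype ι] (A : ι → ι → ℝ) (r : ℝ) : Continuous (Fs A r) := by
  unfold Fs; fun_prop

lemma Fs_QM {ι : Type} [Fintype ι] [DecidableEq ι] (A : ι → ι → ℝ)
    (hA : ∀ i j, i ≠ j → 0 ≤ A i j) (r : ℝ) : QMon (Fs A r) := by
  intro i x y h he
  have := QM_sum A hA i x y h he
  simp only [Fs, he]; linarith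

def Fc {ι : Type} [Fintype ι] (A B : ι → ι → ℝ) (r : ℝ) (y : ι ⊕ ι → ℝ) : ι ⊕ ι → ℝ
  | Sum.inl i => ∑ j, A i j * y (Sum.inl j) + y (Sum.inl i) * (r - y (Sum.inl i))
      + max (y (Sum.inl i)) 0 * y (Sum.inr i)
  | Sum.inr i => ∑ j, B i j * y (Sum.inr j) + y (Sum.inr i) * (r + y (Sum.inr i))
      + max (-y (Sum.inr i)) 0 * y (Sum.inl i)

lemma Fc_cont {ι : Type} [Fintype ι] (A B : ι → ι → ℝ) (r : ℝ) : Continuous (Fc A B r) := by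
  apply continuous_pi
  rintro (i | i) <;> simp only [Fc] <;> fun_prop

lemma Fc_QM {ι : Type} [Fintype ι] [DecidableEq ι] (A B : ι → ι → ℝ)
    (hA : ∀ i j, i ≠ j → 0 ≤ A i j) (hB : ∀ i j, i ≠ j → 0 ≤ B i j) (r : ℝ) : QMon (Fc A B r) := by
  rintro (i | i) x y h he
  · have h1 := QM_sum A hA i (fun j => x (Sum.inl j)) (fun j => y (Sum.inl j)) (fun j => h _) he
    have h2 := mul_le_mul_of_nonneg_left (h (Sum.inr i)) (le_max_right (y (Sum.inl i)) 0)
    simp only [Fc, he]; linarith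
  · have h1 := QM_sum B hB i (fun j => x (Sum.inr j)) (fun j => y (Sum.inr j)) (fun j => h _) he
    have h2 := mul_le_mul_of_nonneg_left (h (Sum.inl i)) (le_max_right (-y (Sum.inr i)) 0)
    simp only [Fc, he]; linarith

lemma sum_neg' {ι : Type} [Fintype ι] (A : ι → ι → ℝ) (i : ι) (x : ι → ℝ) :
    ∑ j, A i j * -x j = -∑ j, A i j * x j := by
  rw [← Finset.sum_neg_distrib]; apply Finset.sum_congr rfl; intros; ring

lemma cont_of {ι : Type} (u ud : ℝ → ι → ℝ) (T : ℝ)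
    (hu : ∀ i t, T ≤ t → HasDerivAt (fun s => u s i) (ud t i) t) (i : ι) :
    ContinuousOn (fun t => u t i) (Set.Ici T) :=
  fun t ht => (hu i t ht).continuousAt.continuousWithinAt

section sol
variable {ι : Type} [Fintype ι] [DecidableEq ι] (A : ι → ι → ℝ)

lemma nonneg_sol (hA : ∀ i j, i ≠ j → 0 ≤ A i j) (r : ℝ) (u v : ℝ → ι → ℝ)
    (hv : ∀ i, ContinuousOn (fun t => v t i) (Set.Ici 0))
    (hu : ∀ i t, 0 ≤ t → HasDerivAt (fun s => u s i)
      (∑ j, A i j * u t j + u t i * (r - u t i - v t i)) t)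
    (hu0 : ∀ i, 0 ≤ u 0 i) : ∀ t, 0 ≤ t → ∀ i, 0 ≤ u t i := by
  have hc := cont_of u (fun t i => ∑ j, A i j * u t j + u t i * (r - u t i - v t i)) 0 hu
  refine comparison A hA 0 u (fun t i => ∑ j, A i j * u t j + u t i * (r - u t i - v t i))
    (fun t i => r - u t i - v t i) hu ?_ ?_ hu0
  · intro i
    exact (continuousOn_const.sub (hc i)).sub (hv i)
  · intro i t _
    apply le_of_eq; ring

lemma bdd_sol (hA : ∀ i j, i ≠ j → 0 ≤ A i j) (r M : ℝ) (u v : ℝ → ι → ℝ)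
    (hu : ∀ i t, 0 ≤ t → HasDerivAt (fun s => u s i)
      (∑ j, A i j * u t j + u t i * (r - u t i - v t i)) t)
    (hun : ∀ t, 0 ≤ t → ∀ i, 0 ≤ u t i) (hvn : ∀ t, 0 ≤ t → ∀ i, 0 ≤ v t i)
    (hAM : ∀ i, ∑ j, A i j * M ≤ 0) (hrM : r ≤ M) (hu0 : ∀ i, u 0 i ≤ M) :
    ∀ t, 0 ≤ t → ∀ i, u t i ≤ M := by
  have hc := cont_of u (fun t i => ∑ j, A i j * u t j + u t i * (r - u t i - v t i)) 0 hu
  have := comparison A hA 0 (fun t i => M - u t i)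
    (fun t i => -(∑ j, A i j * u t j + u t i * (r - u t i - v t i)))
    (fun t i => - u t i) (fun i t ht => (hu i t ht).const_sub M) (fun i => (hc i).neg) ?_
    (fun i => sub_nonneg.2 (hu0 i))
  · intro t ht i
    exact sub_nonneg.1 (this t ht i)
  · intro i t ht
    have h1 : ∑ j, A i j * (M - u t j) = ∑ j, A i j * M - ∑ j, A i j * u t j := by
      rw [← Finset.sum_sub_distrib]; apply Finset.sum_congr rfl; intros; ring
    rw [h1]
    have h2 := mul_nonneg (hun t ht i) (hvn t ht i)
    have h3 := mul_nonneg (hun t ht i) (sub_nonneg.2 hrM)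
    have h4 := hAM i
    nlinarith

lemma pos_sol (hA : ∀ i j, i ≠ j → 0 ≤ A i j)
    (hconn : ∀ (P : ι → Prop) (i0 : ι), P i0 → (∀ i j, i ≠ j → 0 < A i j → P j → P i) → ∀ i, P i)
    (r M : ℝ) (u v : ℝ → ι → ℝ)
    (hu : ∀ i t, 0 ≤ t → HasDerivAt (fun s => u s i)
      (∑ j, A i j * u t j + u t i * (r - u t i - v t i)) t)
    (hun : ∀ t, 0 ≤ t → ∀ i, 0 ≤ u t i)
    (huM : ∀ t, 0 ≤ t → ∀ i, u t i ≤ M) (hvM : ∀ t, 0 ≤ t → ∀ i, v t i ≤ M)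
    (hu0 : u 0 ≠ 0) : ∀ t, 0 < t → ∀ i, 0 < u t i := by
  obtain ⟨i0, hi0⟩ : ∃ i, u 0 i ≠ 0 := by
    by_contra hc
    push Not at hc
    exact hu0 (funext hc)
  have hi0' : 0 < u 0 i0 := lt_of_le_of_ne (hun 0 le_rfl i0) (Ne.symm hi0)
  suffices h : ∀ i, ∀ t, 0 < t → 0 < u t i from fun t ht i => h i t ht
  have hoff : ∀ t, 0 ≤ t → ∀ i j, i ≠ j → A i i * u t i + A i j * u t j ≤ ∑ k, A i k * u t k := by
    intro t ht i j hij
    rw [← Finset.sum_pair (f := fun k => A i k * u t k) hij]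
    apply Finset.sum_le_sum_of_subset_of_nonneg (Finset.subset_univ _)
    intro k _ hk
    have hki : i ≠ k := by
      rintro rfl; simp at hk
    exact mul_nonneg (hA i k hki) (hun t ht k)
  have hdiag : ∀ t, 0 ≤ t → ∀ i, A i i * u t i ≤ ∑ k, A i k * u t k := by
    intro t ht i
    rw [← Finset.sum_singleton (fun k => A i k * u t k) i]
    apply Finset.sum_le_sum_of_subset_of_nonneg (Finset.subset_univ _)
    intro k _ hk
    have hki : i ≠ k := by
      rintro rfl; simp at hk
    exact mul_nonneg (hA i k hki) (hun t ht k)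
  refine hconn (fun i => ∀ t, 0 < t → 0 < u t i) i0 ?_ ?_
  · -- persistence of positivity
    set K : ℝ := -(A i0 i0 + r - 2 * M) with hK
    have hder : ∀ t, 0 ≤ t → HasDerivAt (fun t => Real.exp (K * t) * u t i0)
        (Real.exp (K * t) * K * u t i0 + Real.exp (K * t) *
          (∑ j, A i0 j * u t j + u t i0 * (r - u t i0 - v t i0))) t := by
      intro t ht
      have h1 : HasDerivAt (fun t => Real.exp (K * t)) (Real.exp (K * t) * K) t := by
        have := ((hasDerivAt_id t).const_mul K).exp
        simpa using this
      exact h1.mul (hu i0 t ht)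
    have hmono : MonotoneOn (fun t => Real.exp (K * t) * u t i0) (Set.Ici 0) := by
      apply monotoneOn_of_deriv_nonneg (convex_Ici _)
      · intro t ht
        exact (hder t ht).continuousAt.continuousWithinAt
      · intro t ht
        rw [interior_Ici] at ht
        exact (hder t (le_of_lt ht)).differentiableAt.differentiableWithinAt
      · intro t ht
        rw [interior_Ici] at ht
        have ht' : 0 ≤ t := le_of_lt ht
        rw [(hder t ht').deriv]
        have h1 := hdiag t ht' i0
        have h2 : 0 ≤ K * u t i0 + (∑ j, A i0 j * u t j + u t i0 * (r - u t i0 - v t i0)) := by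
          have h3 := mul_nonneg (hun t ht' i0) (sub_nonneg.2 (huM t ht' i0))
          have h4 := mul_nonneg (hun t ht' i0) (sub_nonneg.2 (hvM t ht' i0))
          rw [hK]; nlinarith
        have := mul_nonneg (Real.exp_pos (K * t)).le h2
        linarith
    intro t ht
    have h1 := hmono (Set.mem_Ici.2 le_rfl) (Set.mem_Ici.2 ht.le) ht.le
    simp only [mul_zero, Real.exp_zero, one_mul] at h1
    exact (mul_pos_iff_of_pos_left (Real.exp_pos (K * t))).1 (lt_of_lt_of_le hi0' h1)
  · intro i j hij hAij hj t ht
    by_contra hc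
    have h0 : u t i = 0 := le_antisymm (not_lt.1 hc) (hun t ht.le i)
    have hmin : IsLocalMin (fun s => u s i) t := by
      filter_upwards [lt_mem_nhds ht] with s hs
      simp only [h0]
      exact hun s hs.le i
    have h1 := hmin.hasDerivAt_eq_zero (hu i t ht.le)
    have h2 := hoff t ht.le i j hij
    have h3 := mul_pos hAij (hj t ht)
    rw [h0] at h1 h2
    linarith

lemma pos_or_zero (hA : ∀ i j, i ≠ j → 0 ≤ A i j)
    (hconn : ∀ (P : ι → Prop) (i0 : ι), P i0 → (∀ i j, i ≠ j → 0 < A i j → P j → P i) → ∀ i, P i)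
    (w p : ι → ℝ) (hw : ∀ i, 0 ≤ w i) (he : ∀ i, ∑ j, A i j * w j + w i * p i = 0) :
    (∀ i, w i = 0) ∨ ∀ i, 0 < w i := by
  by_cases h : ∀ i, w i = 0
  · exact Or.inl h
  right
  push Not at h
  obtain ⟨i0, hi0⟩ := h
  refine hconn (fun i => 0 < w i) i0 (lt_of_le_of_ne (hw i0) (Ne.symm hi0)) ?_
  intro i j hij hAij hj
  by_contra hc
  have h0 : w i = 0 := le_antisymm (not_lt.1 hc) (hw i)
  have h1 := he i
  have h2 : A i j * w j ≤ ∑ k, A i k * w k := by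
    apply Finset.single_le_sum (f := fun k => A i k * w k) _ (Finset.mem_univ j)
    intro k _
    by_cases hk : i = k
    · subst hk; simp [h0]
    · exact mul_nonneg (hA i k hk) (hw k)
  have h3 := mul_pos hAij hj
  rw [h0] at h1
  linarith

lemma exists_small (φ c : ι → ℝ) (hφ : ∀ i, 0 < φ i) (hc : ∀ i, 0 < c i) :
    ∃ δ : ℝ, 0 < δ ∧ ∀ i, δ * φ i ≤ c i := by
  rcases isEmpty_or_nonempty ι with h | h
  · exact ⟨1, one_pos, fun i => h.elim i⟩
  obtain ⟨k, hk⟩ := Finite.exists_min (fun i => c i / φ i)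
  refine ⟨c k / φ k, div_pos (hc k) (hφ k), fun i => ?_⟩
  rw [← le_div_iff₀ (hφ i)]; exact hk i

/-- persistence -/
lemma persist (hA : ∀ i j, i ≠ j → 0 ≤ A i j) (r : ℝ) (u v : ℝ → ι → ℝ)
    (hv : ∀ i, ContinuousOn (fun t => v t i) (Set.Ici 0))
    (hu : ∀ i t, 0 ≤ t → HasDerivAt (fun s => u s i)
      (∑ j, A i j * u t j + u t i * (r - u t i - v t i)) t)
    (hup : ∀ t, 0 < t → ∀ i, 0 < u t i)
    (V φ : ι → ℝ) (hφ : ∀ i, 0 < φ i)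
    (hφs : ∀ i, 0 < ∑ j, A i j * φ j + φ i * (r - V i))
    (hV : ∀ ε > 0, ∀ᶠ t in atTop, ∀ i, v t i < V i + ε) :
    ∃ δ T : ℝ, 0 < δ ∧ (∀ t, T ≤ t → ∀ i, δ * φ i ≤ u t i) ∧
      ∀ i, 0 ≤ ∑ j, A i j * (δ * φ j) + δ * φ i * (r - δ * φ i - V i) := by
  have hc := cont_of u (fun t i => ∑ j, A i j * u t j + u t i * (r - u t i - v t i)) 0 hu
  obtain ⟨κ, hκ, hκs⟩ := exists_small φ (fun i => ∑ j, A i j * φ j + φ i * (r - V i)) hφ hφs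
  obtain ⟨T, hT⟩ := eventually_atTop.1 ((hV (κ/2) (by linarith)).and (eventually_gt_atTop 0))
  have hT0 : 0 < T := (hT T le_rfl).2
  obtain ⟨δ, hδ, hδs⟩ := exists_small φ (fun i => min (κ/2) (u T i)) hφ
    (fun i => lt_min (by linarith) (hup T hT0 i))
  have hsum : ∀ i, ∑ j, A i j * (δ * φ j) = δ * ∑ j, A i j * φ j := by
    intro i
    rw [Finset.mul_sum]; apply Finset.sum_congr rfl; intros; ring
  have hg : ∀ i, 0 ≤ δ * (∑ j, A i j * φ j + φ i * (r - V i) - φ i * (κ/2) - φ i * (δ * φ i)) := by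
    intro i
    apply mul_nonneg hδ.le
    have h1 := hκs i
    have h2 := mul_le_mul_of_nonneg_left ((hδs i).trans (min_le_left _ _)) (hφ i).le
    try simp only at h1
    try simp only at h2
    linarith
  refine ⟨δ, T, hδ, ?_, ?_⟩
  · have := comparison A hA T (fun t i => u t i - δ * φ i)
      (fun t i => ∑ j, A i j * u t j + u t i * (r - u t i - v t i))
      (fun t i => r - κ/2 - V i - u t i - δ * φ i)
      (fun i t ht => (hu i t (hT0.le.trans ht)).sub_const _) ?_ ?_
      (fun i => sub_nonneg.2 ((hδs i).trans (min_le_right _ _)))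
    · intro t ht i
      exact sub_nonneg.1 (this t ht i)
    · intro i
      exact ((continuousOn_const.sub ((hc i).mono (Set.Ici_subset_Ici.2 hT0.le)))).sub continuousOn_const
    · intro i t ht
      have h1 : ∑ j, A i j * (u t j - δ * φ j) = ∑ j, A i j * u t j - δ * ∑ j, A i j * φ j := by
        rw [← hsum, ← Finset.sum_sub_distrib]; apply Finset.sum_congr rfl; intros; ring
      rw [h1]
      have h2 := hg i
      have h3 := mul_nonneg (hup t (hT0.trans_le ht) i).le (sub_nonneg.2 ((hT t ht).1 i).le)
      nlinarith
  · intro i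
    rw [hsum]
    have h2 := hg i
    have h3 : 0 ≤ δ * (φ i * (κ/2)) := by have := hφ i; positivity
    nlinarith
end sol

section core
variable (n : ℕ) (hn : 2 ≤ n) (r d₁ q₁ d₂ q₂ : ℝ)
    (hr : 0 < r) (hd1 : 0 < d₁) (hq1 : 0 < q₁) (hd2 : 0 < d₂) (hq2 : 0 < q₂)
    (hG1 : d₂ ≤ d₁ / q₁ * q₂) (hG2 : q₁ ≤ q₂) (hG3 : (d₂, q₂) ≠ (d₁, q₁))

include hn hd1 hq1 hd2 hq2 in
lemma P_fin (u v : Fin n → ℝ) (hu : ∀ i, 0 ≤ u i) (hv : ∀ i, 0 ≤ v i) (huv : ∀ i, 0 < u i + v i)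
    (eu : ∀ i, ∑ j, Lm n d₁ q₁ i j * u j + u i * (r - u i - v i) = 0)
    (ev : ∀ i, ∑ j, Lm n d₂ q₂ i j * v j + v i * (r - u i - v i) = 0) :
    ∀ i, 0 < r - u i - v i := by
  have hx : ∀ (w : Fin n → ℝ) k (hk : k < n), ext0 w k = w ⟨k, hk⟩ := fun w k hk => by simp [ext0, hk]
  have := lemP n hn r d₁ q₁ d₂ q₂ hd1 hq1 hd2 hq2 (ext0 u) (ext0 v)
    (fun k hk => by rw [hx u k hk]; exact hu _) (fun k hk => by rw [hx v k hk]; exact hv _)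
    (fun k hk => by rw [hx u k hk, hx v k hk]; exact huv _)
    (fun k hk => by
      have := eu ⟨k, hk⟩
      rw [Lm_row' n hn] at this
      rw [hx u k hk, hx v k hk]; exact this)
    (fun k hk => by
      have := ev ⟨k, hk⟩
      rw [Lm_row' n hn] at this
      rw [hx u k hk, hx v k hk]; exact this)
  intro i
  have h := this i i.2
  rwa [ext0_fin, ext0_fin] at h

include hn hd1 hq1 hd2 hq2 hG1 hG2 hG3 in
lemma Phi_fin (w p : Fin n → ℝ) (hw : ∀ i, 0 < w i) (hp : ∀ i, 0 < p i)
    (e : ∀ i, ∑ j, Lm n d₂ q₂ i j * w j + w i * p i = 0) :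
    ∃ φ : Fin n → ℝ, (∀ i, 0 < φ i) ∧ ∀ i, 0 < ∑ j, Lm n d₁ q₁ i j * φ j + φ i * p i := by
  have hx : ∀ (w : Fin n → ℝ) k (hk : k < n), ext0 w k = w ⟨k, hk⟩ := fun w k hk => by simp [ext0, hk]
  obtain ⟨Φ, h1, h2⟩ := lemPhi n hn d₁ q₁ d₂ q₂ hd1 hq1 hd2 hq2 hG1 hG2 hG3 (ext0 w) (ext0 p)
    (fun k hk => by rw [hx w k hk]; exact hw _) (fun k hk => by rw [hx p k hk]; exact hp _)
    (fun k hk => by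
      have := e ⟨k, hk⟩
      rw [Lm_row' n hn] at this
      rw [hx w k hk, hx p k hk]; exact this)
  refine ⟨fun i => Φ i, fun i => h1 _, fun i => ?_⟩
  have := h2 i i.2
  rw [Lm_row n hn, ← ext0_fin p]; exact this

include hn hd1 hq1 hd2 hq2 hG1 hG2 hG3 in
/-- no coexistence -/
lemma no_coex (u v : Fin n → ℝ) (hu : ∀ i, 0 < u i) (hv : ∀ i, 0 ≤ v i)
    (eu : ∀ i, ∑ j, Lm n d₁ q₁ i j * u j + u i * (r - u i - v i) = 0)
    (ev : ∀ i, ∑ j, Lm n d₂ q₂ i j * v j + v i * (r - u i - v i) = 0) : ∀ i, v i = 0 := by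
  rcases pos_or_zero (Lm n d₂ q₂) (Lm_off n d₂ q₂ hd2 hq2) (Lm_conn n d₂ q₂ hd2 hq2) v
    (fun i => r - u i - v i) hv ev with h | h
  · exact h
  exfalso
  have hp := P_fin n hn r d₁ q₁ d₂ q₂ hd1 hq1 hd2 hq2 u v (fun i => (hu i).le) hv
    (fun i => add_pos (hu i) (h i)) eu ev
  obtain ⟨φ, h1, h2⟩ := Phi_fin n hn d₁ q₁ d₂ q₂ hd1 hq1 hd2 hq2 hG1 hG2 hG3 v _ h hp ev
  have : Nonempty (Fin n) := ⟨⟨0, by omega⟩⟩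
  exact no_strict (Lm n d₁ q₁) (Lm_off n d₁ q₁ hd1 hq1) _ φ u h1 hu h2 eu

include hn hd1 hq1 hd2 hq2 hG1 hG2 hG3 in
/-- instability of single-species equilibria of the loser -/
lemma exists_phi_pos (v : Fin n → ℝ) (hv : ∀ i, 0 < v i)
    (ev : ∀ i, ∑ j, Lm n d₂ q₂ i j * v j + v i * (r - v i) = 0) :
    ∃ φ : Fin n → ℝ, (∀ i, 0 < φ i) ∧ ∀ i, 0 < ∑ j, Lm n d₁ q₁ i j * φ j + φ i * (r - v i) := by
  have hp := P_fin n hn r d₁ q₁ d₂ q₂ hd1 hq1 hd2 hq2 (fun _ => 0) v (fun i => le_rfl)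
    (fun i => (hv i).le) (fun i => by simpa using hv i) (by simp) (by simpa using ev)
  exact Phi_fin n hn d₁ q₁ d₂ q₂ hd1 hq1 hd2 hq2 hG1 hG2 hG3 v _ hv (by simpa using hp) ev

include hn hr hd1 hq1 hd2 hq2 hG1 hG2 hG3 in
theorem core (ustar : Fin n → ℝ) (hustar : ∀ i, 0 < ustar i)
    (hueq : ∀ i, ∑ j, Lm n d₁ q₁ i j * ustar j + ustar i * (r - ustar i) = 0)
    (u v : ℝ → Fin n → ℝ)
    (hu : ∀ i, ∀ t : ℝ, 0 ≤ t → HasDerivAt (fun s => u s i)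
      (∑ j, Lm n d₁ q₁ i j * u t j + u t i * (r - u t i - v t i)) t)
    (hv : ∀ i, ∀ t : ℝ, 0 ≤ t → HasDerivAt (fun s => v s i)
      (∑ j, Lm n d₂ q₂ i j * v t j + v t i * (r - v t i - u t i)) t)
    (hu0 : ∀ i, 0 ≤ u 0 i) (hv0 : ∀ i, 0 ≤ v 0 i) (hne : u 0 ≠ 0) :
    ∀ i, Tendsto (fun t => u t i) atTop (nhds (ustar i)) ∧
           Tendsto (fun t => v t i) atTop (nhds 0) := by
  have hA := Lm_off n d₁ q₁ hd1 hq1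
  have hB := Lm_off n d₂ q₂ hd2 hq2
  have cu := cont_of u _ 0 hu
  have cv := cont_of v _ 0 hv
  have un := nonneg_sol _ hA r u v cv hu hu0
  have vn := nonneg_sol _ hB r v u cu hv hv0
  obtain ⟨M, hM0, hrM, huM, hvM⟩ : ∃ M : ℝ, 0 ≤ M ∧ r ≤ M ∧ (∀ i, u 0 i ≤ M) ∧ ∀ i, v 0 i ≤ M := by
    have s1 : 0 ≤ ∑ i, u 0 i := Finset.sum_nonneg (fun i _ => hu0 i)
    have s2 : 0 ≤ ∑ i, v 0 i := Finset.sum_nonneg (fun i _ => hv0 i)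
    refine ⟨r + ∑ i, u 0 i + ∑ i, v 0 i, by linarith, by linarith, fun i => ?_, fun i => ?_⟩
    · have := Finset.single_le_sum (f := fun i => u 0 i) (fun j _ => hu0 j) (Finset.mem_univ i)
      linarith
    · have := Finset.single_le_sum (f := fun i => v 0 i) (fun j _ => hv0 j) (Finset.mem_univ i)
      linarith
  have ub := bdd_sol _ hA r M u v hu un vn (Lm_const n hn d₁ q₁ M hq1 hM0) hrM huM
  have vb := bdd_sol _ hB r M v u hv vn un (Lm_const n hn d₂ q₂ M hq2 hM0) hrM hvM
  have up := pos_sol _ hA (Lm_conn n d₁ q₁ hd1 hq1) r M u v hu un ub vb hne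
  -- limits
  have e1 : ∀ i, ∃ m, IsLI (fun t => u t i) m :=
    fun i => exists_LI _ 0 M (fun t ht => ⟨un t ht i, ub t ht i⟩)
  have e2 : ∀ i, ∃ m, IsLI (fun t => - v t i) m :=
    fun i => exists_LI _ (-M) 0 (fun t ht => ⟨neg_le_neg (vb t ht i), by linarith [vn t ht i]⟩)
  have e3 : ∀ i, ∃ m, IsLI (fun t => - u t i) m :=
    fun i => exists_LI _ (-M) 0 (fun t ht => ⟨neg_le_neg (ub t ht i), by linarith [un t ht i]⟩)
  choose a ha using e1
  choose b hb using e2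
  choose c hc using e3
  have b0 : ∀ i, b i ≤ 0 := fun i => LI_le (hb i) (T := 0) (fun t ht => by linarith [vn t ht i])
  have bM : ∀ i, -M ≤ b i := fun i => LI_ge (hb i) (T := 0) (fun t ht => by linarith [vb t ht i])
  have c0 : ∀ i, c i ≤ 0 := fun i => LI_le (hc i) (T := 0) (fun t ht => by linarith [un t ht i])
  have a0 : ∀ i, 0 ≤ a i := fun i => LI_ge (ha i) (T := 0) (fun t ht => un t ht i)
  -- fluctuation inequalities
  have f1 : Fc (Lm n d₁ q₁) (Lm n d₂ q₂) r (Sum.elim a b) ≤ 0 := by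
    refine fluct _ (Fc_cont _ _ r) (Fc_QM _ _ hA hB r) (fun t => Sum.elim (u t) (fun i => - v t i))
      (fun t => Sum.elim (fun i => ∑ j, Lm n d₁ q₁ i j * u t j + u t i * (r - u t i - v t i))
        (fun i => -(∑ j, Lm n d₂ q₂ i j * v t j + v t i * (r - v t i - u t i)))) ?_ ?_ _ ?_
    · rintro (i | i) t ht
      · exact hu i t ht
      · exact (hv i t ht).neg
    · rintro (i | i) t ht
      · simp only [Fc, Sum.elim_inl, Sum.elim_inr, max_eq_left (un t ht i)]
        apply le_of_eq; ring
      · simp only [Fc, Sum.elim_inl, Sum.elim_inr, neg_neg, max_eq_left (vn t ht i), sum_neg']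
        apply le_of_eq; ring
    · rintro (i | i)
      · exact ha i
      · exact hb i
  have f2 : Fs (Lm n d₂ q₂) r b ≤ 0 := by
    refine fluct _ (Fs_cont _ r) (Fs_QM _ hB r) (fun t i => - v t i)
      (fun t i => -(∑ j, Lm n d₂ q₂ i j * v t j + v t i * (r - v t i - u t i)))
      (fun i t ht => (hv i t ht).neg) ?_ b hb
    intro i t ht
    simp only [Fs, sum_neg']
    have := mul_nonneg (vn t ht i) (un t ht i)
    nlinarith
  have f3 : Fs (Lm n d₁ q₁) r c ≤ 0 := by
    refine fluct _ (Fs_cont _ r) (Fs_QM _ hA r) (fun t i => - u t i)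
      (fun t i => -(∑ j, Lm n d₁ q₁ i j * u t j + u t i * (r - u t i - v t i)))
      (fun i t ht => (hu i t ht).neg) ?_ c hc
    intro i t ht
    simp only [Fs, sum_neg']
    have := mul_nonneg (un t ht i) (vn t ht i)
    nlinarith
  -- an equilibrium of the loser above the limsup of v
  obtain ⟨w, -, hwb, hw⟩ := exists_zero _ (Fs_cont (Lm n d₂ q₂) r) (Fs_QM _ hB r)
    (fun _ => -M) b bM (by
      intro i
      simp only [Fs, Pi.zero_apply]
      have h1 := Lm_const n hn d₂ q₂ M hq2 hM0 i
      have h2 := sum_neg' (Lm n d₂ q₂) i (fun _ => M)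
      have h3 := mul_nonneg hM0 (sub_nonneg.2 hrM)
      try simp only at h2
      rw [h2]; nlinarith) f2
  have ew : ∀ i, ∑ j, Lm n d₂ q₂ i j * (-w j) + (-w i) * (r - (-w i)) = 0 := by
    intro i
    have := congrFun hw i
    simp only [Fs, Pi.zero_apply] at this
    rw [sum_neg']; linarith
  have wn : ∀ i, 0 ≤ -w i := fun i => by linarith [hwb i, b0 i]
  obtain ⟨φ, hφ, hφs⟩ : ∃ φ : Fin n → ℝ, (∀ i, 0 < φ i) ∧
      ∀ i, 0 < ∑ j, Lm n d₁ q₁ i j * φ j + φ i * (r - (-w i)) := by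
    rcases pos_or_zero _ hB (Lm_conn n d₂ q₂ hd2 hq2) (fun i => -w i) (fun i => r - (-w i)) wn ew
      with h | h
    · refine ⟨ustar, hustar, fun i => ?_⟩
      rw [h i]
      have h1 := hueq i
      have h2 := mul_pos (hustar i) (hustar i)
      linarith
    · exact exists_phi_pos n hn r d₁ q₁ d₂ q₂ hd1 hq1 hd2 hq2 hG1 hG2 hG3 (fun i => -w i) h ew
  obtain ⟨δ, T, hδ, hper, hsub⟩ := persist _ hA r u v cv hu up (fun i => -w i) φ hφ hφs (by
    intro ε hε
    rw [eventually_all]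
    intro i
    filter_upwards [(hb i).1 ε hε] with t ht
    have := hwb i
    linarith)
  have hδa : ∀ i, δ * φ i ≤ a i := fun i => LI_ge (ha i) (T := T) (fun t ht => hper t ht i)
  have hφδ : ∀ i, 0 < δ * φ i := fun i => mul_pos hδ (hφ i)
  -- coexistence equilibrium
  obtain ⟨x, hx1, hx2, hx⟩ := exists_zero _ (Fc_cont (Lm n d₁ q₁) (Lm n d₂ q₂) r) (Fc_QM _ _ hA hB r)
    (Sum.elim (fun i => δ * φ i) w) (Sum.elim a b) (by
      rintro (i | i)
      · exact hδa i
      · exact hwb i) (by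
      rintro (i | i)
      · simp only [Fc, Sum.elim_inl, Sum.elim_inr, Pi.zero_apply, max_eq_left (hφδ i).le]
        have := hsub i
        nlinarith
      · have h1 := congrFun hw i
        simp only [Fs, Pi.zero_apply] at h1
        simp only [Fc, Sum.elim_inl, Sum.elim_inr, Pi.zero_apply]
        rw [h1, zero_add]
        exact mul_nonneg (le_max_right _ _) (hφδ i).le) f1
  have xu : ∀ i, 0 < x (Sum.inl i) := fun i => lt_of_lt_of_le (hφδ i) (hx1 (Sum.inl i))
  have xb : ∀ i, x (Sum.inr i) ≤ b i := fun i => hx2 (Sum.inr i)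
  have xv : ∀ i, 0 ≤ - x (Sum.inr i) := fun i => by linarith [xb i, b0 i]
  have hzero := no_coex n hn r d₁ q₁ d₂ q₂ hd1 hq1 hd2 hq2 hG1 hG2 hG3
    (fun i => x (Sum.inl i)) (fun i => - x (Sum.inr i)) xu xv (by
      intro i
      have h1 := congrFun hx (Sum.inl i)
      simp only [Fc, Pi.zero_apply, max_eq_left (xu i).le] at h1
      linarith) (by
      intro i
      have h1 := congrFun hx (Sum.inr i)
      simp only [Fc, Pi.zero_apply, max_eq_left (xv i)] at h1
      rw [sum_neg']
      linarith)
  have hb0 : ∀ i, b i = 0 := fun i => le_antisymm (b0 i) (by linarith [xb i, hzero i])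
  have hage : ∀ i, ustar i ≤ a i := by
    apply sub_le_super _ hA r ustar a (fun i => (hustar i).le)
      (fun i => lt_of_lt_of_le (hφδ i) (hδa i)) (fun i => (hueq i).ge)
    intro i
    have h1 := f1 (Sum.inl i)
    simp only [Fc, Sum.elim_inl, Sum.elim_inr, hb0 i, mul_zero, add_zero, Pi.zero_apply] at h1
    exact h1
  have hcle : ∀ i, - c i ≤ ustar i := by
    apply sub_le_super _ hA r (fun i => - c i) ustar (fun i => by linarith [c0 i]) hustar _
      (fun i => (hueq i).le)
    intro i
    have h1 := f3 i
    simp only [Fs, Pi.zero_apply] at h1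
    rw [sum_neg']; linarith
  intro i
  constructor
  · rw [tendsto_order]
    constructor
    · intro y hy
      filter_upwards [(ha i).1 (ustar i - y) (by linarith)] with t ht
      linarith [hage i]
    · intro y hy
      filter_upwards [(hc i).1 (y - ustar i) (by linarith)] with t ht
      linarith [hcle i]
  · rw [tendsto_order]
    constructor
    · intro y hy
      filter_upwards [eventually_ge_atTop 0] with t ht
      linarith [vn t ht i]
    · intro y hy
      filter_upwards [(hb i).1 y hy] with t ht
      linarith [hb0 i]

include hn hr hd1 hq1 hd2 hq2 hG1 hG2 hG3 in
/-- existence of the winner's equilibrium from that of the loser -/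
theorem exists_star (v : Fin n → ℝ) (hv : ∀ i, 0 < v i)
    (ev : ∀ i, ∑ j, Lm n d₂ q₂ i j * v j + v i * (r - v i) = 0) :
    ∃ u : Fin n → ℝ, (∀ i, 0 < u i) ∧ ∀ i, ∑ j, Lm n d₁ q₁ i j * u j + u i * (r - u i) = 0 := by
  have hA := Lm_off n d₁ q₁ hd1 hq1
  obtain ⟨φ, hφ, hφs⟩ := exists_phi_pos n hn r d₁ q₁ d₂ q₂ hd1 hq1 hd2 hq2 hG1 hG2 hG3 v hv ev
  obtain ⟨δ, hδ, hδs⟩ := exists_small φ (fun i => min (v i) r) hφ (fun i => lt_min (hv i) hr)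
  obtain ⟨w, -, hwb, hw⟩ := exists_zero _ (Fs_cont (Lm n d₁ q₁) r) (Fs_QM _ hA r)
    (fun _ => -r) (fun i => -(δ * φ i)) (fun i => by
      have := (hδs i).trans (min_le_right _ _); linarith) (by
      intro i
      simp only [Fs, Pi.zero_apply]
      have h1 := Lm_const n hn d₁ q₁ r hq1 hr.le i
      have h2 := sum_neg' (Lm n d₁ q₁) i (fun _ => r)
      try simp only at h2
      rw [h2]; nlinarith) (by
      intro i
      have hsum : ∑ j, Lm n d₁ q₁ i j * (δ * φ j) = δ * ∑ j, Lm n d₁ q₁ i j * φ j := by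
        rw [Finset.mul_sum]; apply Finset.sum_congr rfl; intros; ring
      have h2 := sum_neg' (Lm n d₁ q₁) i (fun i => δ * φ i)
      simp only [Fs, Pi.zero_apply]
      try simp only at h2
      rw [h2, hsum]
      have h3 := mul_pos hδ (hφs i)
      have h4 := mul_nonneg (mul_pos hδ (hφ i)).le (sub_nonneg.2 ((hδs i).trans (min_le_left _ _)))
      nlinarith)
  refine ⟨fun i => - w i, fun i => ?_, fun i => ?_⟩
  · have h1 := hwb i
    have h2 := mul_pos hδ (hφ i)
    try simp only at h1
    linarith
  · have := congrFun hw i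
    simp only [Fs, Pi.zero_apply] at this
    show ∑ j, Lm n d₁ q₁ i j * -w j + -w i * (r - -w i) = 0
    rw [sum_neg']; linarith
end core

/-- in case (a), if `(d₂,q₂) ∈ G₁` then the `u`-only equilibrium `(u*,0)` is
globally attracting (for `u(0) ≠ 0`), and if `(d₂,q₂) ∈ G₂` then the `v`-only equilibrium
`(0,v*)` exists uniquely and is globally attracting (for `v(0) ≠ 0`). -/
theorem stmt_17 (n : ℕ) (hn : 2 ≤ n) (r d₁ q₁ d₂ q₂ : ℝ)
    (hr : 0 < r) (hd1 : 0 < d₁) (hq1 : 0 < q₁) (hd2 : 0 < d₂) (hq2 : 0 < q₂)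
    (ustar : Fin n → ℝ) (hustar : ∀ i, 0 < ustar i)
    (hueq : ∀ i, (∑ j, (d₁ * Da n i j + q₁ * Qm n i j) * ustar j)
      + ustar i * (r - ustar i) = 0)
    (u v : ℝ → Fin n → ℝ)
    (hu : ∀ i, ∀ t : ℝ, 0 ≤ t → HasDerivAt (fun s => u s i)
      ((∑ j, (d₁ * Da n i j + q₁ * Qm n i j) * u t j)
        + u t i * (r - u t i - v t i)) t)
    (hv : ∀ i, ∀ t : ℝ, 0 ≤ t → HasDerivAt (fun s => v s i)
      ((∑ j, (d₂ * Da n i j + q₂ * Qm n i j) * v t j)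
        + v t i * (r - u t i - v t i)) t)
    (hu0 : ∀ i, 0 ≤ u 0 i) (hv0 : ∀ i, 0 ≤ v 0 i) :
    ((d₂ ≤ d₁ / q₁ * q₂ ∧ q₁ ≤ q₂ ∧ (d₂, q₂) ≠ (d₁, q₁)) → u 0 ≠ 0 →
      ∀ i, Tendsto (fun t => u t i) atTop (nhds (ustar i)) ∧
           Tendsto (fun t => v t i) atTop (nhds 0)) ∧
    ((d₁ / q₁ * q₂ ≤ d₂ ∧ q₂ ≤ q₁ ∧ (d₂, q₂) ≠ (d₁, q₁)) → v 0 ≠ 0 →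
      ∃ vstar : Fin n → ℝ, (∀ i, 0 < vstar i) ∧
        (∀ i, (∑ j, (d₂ * Da n i j + q₂ * Qm n i j) * vstar j)
          + vstar i * (r - vstar i) = 0) ∧
        (∀ w : Fin n → ℝ, (∀ i, 0 < w i) →
          (∀ i, (∑ j, (d₂ * Da n i j + q₂ * Qm n i j) * w j)
            + w i * (r - w i) = 0) → w = vstar) ∧
        ∀ i, Tendsto (fun t => u t i) atTop (nhds 0) ∧
             Tendsto (fun t => v t i) atTop (nhds (vstar i))) := by
  have hv' : ∀ i, ∀ t : ℝ, 0 ≤ t → HasDerivAt (fun s => v s i)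
      (∑ j, Lm n d₂ q₂ i j * v t j + v t i * (r - v t i - u t i)) t := by
    intro i t ht
    refine (hv i t ht).congr_deriv ?_
    simp only [Lm]; ring
  constructor
  · rintro ⟨h1, h2, h3⟩ hne
    exact core n hn r d₁ q₁ d₂ q₂ hr hd1 hq1 hd2 hq2 h1 h2 h3 ustar hustar hueq u v hu hv' hu0 hv0 hne
  · rintro ⟨h1, h2, h3⟩ hne
    have h1' : d₁ ≤ d₂ / q₂ * q₁ := by
      rw [div_mul_eq_mul_div, div_le_iff₀ hq1] at h1
      rw [div_mul_eq_mul_div, le_div_iff₀ hq2]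
      exact h1
    obtain ⟨vs, hvs, evs⟩ := exists_star n hn r d₂ q₂ d₁ q₁ hr hd2 hq2 hd1 hq1 h1' h2 h3.symm
      ustar hustar hueq
    refine ⟨vs, hvs, evs, ?_, ?_⟩
    · intro w hw ew
      have hB := Lm_off n d₂ q₂ hd2 hq2
      funext i
      apply le_antisymm
      · exact sub_le_super _ hB r w vs (fun i => (hw i).le) hvs (fun i => (ew i).ge)
          (fun i => (evs i).le) i
      · exact sub_le_super _ hB r vs w (fun i => (hvs i).le) hw (fun i => (evs i).ge)
          (fun i => (ew i).le) i
    · intro i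
      exact (core n hn r d₂ q₂ d₁ q₁ hr hd2 hq2 hd1 hq1 h1' h2 h3.symm vs hvs evs v u hv' hu
        hv0 hu0 hne i).symm
end
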